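/- arXiv:2410.06937 — 4 statements merged into one kernel-verified Lean document; each statement's English description precedes it below -/
import Mathlib

section
/- If X ~ N(μ, Σ) on ℝ^d and f : ℝ^d → ℝ is Lipschitz (with respect to the Euclidean distance) with E f(X) = 0, then for all x > 0, P(f(X) ≥ x) ≤ exp(-x² / (2‖Σ^{1/2}∇f‖²_∞)), where ‖Σ^{1/2}∇f‖²_∞ = sup_x ⟨∇f(x), Σ∇f(x)⟩. -/
open MeasureTheory Finset

/-- `X ~ N(m, S)` on `ℝ^d`, expressed via the characteristic function. -/
def IsGaussianMeasure {d : ℕ} (P : Measure (EuclideanSpace ℝ (Fin d)))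
    (m : EuclideanSpace ℝ (Fin d)) (S : Matrix (Fin d) (Fin d) ℝ) : Prop :=
  IsProbabilityMeasure P ∧
  ∀ t : EuclideanSpace ℝ (Fin d),
    ∫ x, Complex.exp (Complex.I * ((∑ i, t i * x i : ℝ) : ℂ)) ∂P =
      Complex.exp (Complex.I * ((∑ i, m i * t i : ℝ) : ℂ) -
        ((∑ i, ∑ j, S i j * t i * t j : ℝ) : ℂ) / 2)

/-- `(X_α, Y_α)` Gaussian on `ℝ^d × ℝ^d` with mean `(m, m)` and block covariance
`[[S, αS], [αS, S]]`, expressed via the characteristic function. -/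
def IsJointGaussianMeasure {d : ℕ}
    (Q : Measure (EuclideanSpace ℝ (Fin d) × EuclideanSpace ℝ (Fin d)))
    (m : EuclideanSpace ℝ (Fin d)) (S : Matrix (Fin d) (Fin d) ℝ) (α : ℝ) : Prop :=
  IsProbabilityMeasure Q ∧
  ∀ t s : EuclideanSpace ℝ (Fin d),
    ∫ p, Complex.exp (Complex.I * ((∑ i, t i * p.1 i + ∑ i, s i * p.2 i : ℝ) : ℂ)) ∂Q =
      Complex.exp (Complex.I * ((∑ i, m i * (t i + s i) : ℝ) : ℂ) -
        (((∑ i, ∑ j, S i j * t i * t j) + (∑ i, ∑ j, S i j * s i * s j)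
          + 2 * α * (∑ i, ∑ j, S i j * t i * s j) : ℝ) : ℂ) / 2)


open ProbabilityTheory Filter Topology
open scoped MatrixOrder Matrix.Norms.L2Operator

/-- Directional Lipschitz bound from an a.e. bound on the derivative. -/
lemma dir_lip {E : Type*} [NormedAddCommGroup E] [NormedSpace ℝ E] [FiniteDimensional ℝ E]
    [MeasurableSpace E] [BorelSpace E] (ν : Measure E) [ν.IsAddHaarMeasure]
    (f : E → ℝ) (C : NNReal) (hf : LipschitzWith C f) (v : E) (a : ℝ)
    (h : ∀ y, DifferentiableAt ℝ f y → fderiv ℝ f y v ≤ a) (x : E) :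
    f (x + v) - f x ≤ a := by
  have hmeas : MeasurableSet {y | DifferentiableAt ℝ f y} := measurableSet_of_differentiableAt ℝ f
  have h1 : ∀ᵐ t : ℝ, ∀ᵐ y ∂ν, DifferentiableAt ℝ f (y + t • v) := by
    refine Eventually.of_forall fun t => ?_
    exact (measurePreserving_add_right ν (t • v)).quasiMeasurePreserving.ae
      (hf.ae_differentiableAt (μ := ν))
  have h2 : ∀ᵐ y ∂ν, ∀ᵐ t : ℝ, DifferentiableAt ℝ f (y + t • v) := by
    refine (Measure.ae_ae_comm (μ := (volume : Measure ℝ)) (ν := ν)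
      (p := fun t y => DifferentiableAt ℝ f (y + t • v)) ?_).1 h1
    have : Measurable (fun p : ℝ × E => p.2 + p.1 • v) := by fun_prop
    exact this hmeas
  have h3 : ∀ᵐ y ∂ν, f (y + v) - f y ≤ a := by
    filter_upwards [h2] with y hy
    have hl : LipschitzWith (C * ‖v‖₊) (fun t : ℝ => f (y + t • v)) := by
      refine LipschitzWith.of_dist_le_mul fun s t => ?_
      refine (hf.dist_le_mul _ _).trans ?_
      simp only [dist_add_left, NNReal.coe_mul, coe_nnnorm, mul_assoc]
      gcongr
      rw [dist_eq_norm, ← sub_smul, norm_smul, dist_eq_norm, mul_comm]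
    have hac := (hl.lipschitzOnWith (s := Set.uIcc 0 1)).absolutelyContinuousOnInterval
    have hi := hac.integral_deriv_eq_sub
    have hle : ∫ t in (0:ℝ)..1, deriv (fun t : ℝ => f (y + t • v)) t ≤ ∫ t in (0:ℝ)..1, a := by
      refine intervalIntegral.integral_mono_ae zero_le_one hac.intervalIntegrable_deriv
        (by simp) ?_
      filter_upwards [hy] with t ht
      have hd : HasDerivAt (fun t : ℝ => y + t • v) v t := by
        simpa using ((hasDerivAt_id t).smul_const v).const_add y
      have := ht.hasFDerivAt.comp_hasDerivAt t hd
      rw [show deriv (fun t : ℝ => f (y + t • v)) t = _ from this.deriv]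
      exact h _ ht
    rw [hi] at hle
    simpa using hle
  have hcl : IsClosed {y | f (y + v) - f y ≤ a} := by
    have := hf.continuous
    exact isClosed_le (by fun_prop) (by fun_prop)
  have hd : Dense {y | f (y + v) - f y ≤ a} := Measure.dense_of_ae h3
  have := hcl.closure_eq ▸ hd x
  exact this

section Gauss
variable {d : ℕ}

local notation "𝔼" => EuclideanSpace ℝ (Fin d)

noncomputable def gdens (x : EuclideanSpace ℝ (Fin d)) : ℝ := Real.exp (-(1/2 : ℝ) * ‖x‖ ^ 2)

noncomputable def gconst (d : ℕ) : ℝ := ((2 * Real.pi) ^ ((d : ℝ) / 2))⁻¹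

lemma gconst_pos : 0 < gconst d := by unfold gconst; positivity

lemma gdens_nonneg (x : EuclideanSpace ℝ (Fin d)) : 0 ≤ gdens x := Real.exp_nonneg _

lemma gdens_cont : Continuous (gdens (d := d)) := by unfold gdens; fun_prop

lemma integrable_gdens : Integrable (gdens (d := d)) volume := by
  have := (GaussianFourier.integrable_cexp_neg_mul_sq_norm_add (V := 𝔼) (b := (1/2 : ℂ)) (by norm_num) 0 0).norm
  refine this.congr (Eventually.of_forall fun x => ?_)
  simp only [Complex.norm_exp, gdens]
  congr 1
  simp [← Complex.ofReal_pow]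

lemma stdGaussian_eq_dens : stdGaussian 𝔼 =
    volume.withDensity (fun x => ((Real.toNNReal (gconst d * gdens x) : NNReal) : ENNReal)) := by
  have hm : Measurable (fun x : 𝔼 => Real.toNNReal (gconst d * gdens x)) :=
    ((gdens_cont.measurable).const_mul _).real_toNNReal
  have hfin : IsFiniteMeasure (volume.withDensity (fun x : 𝔼 => ((Real.toNNReal (gconst d * gdens x) : NNReal) : ENNReal))) := by
    refine isFiniteMeasure_withDensity_ofReal (f := fun x : 𝔼 => gconst d * gdens x) ?_
    exact (integrable_gdens.const_mul _).2
  refine Measure.ext_of_charFun ?_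
  ext t
  rw [charFun_stdGaussian, charFun_apply, integral_withDensity_eq_integral_smul hm]
  have h := GaussianFourier.integral_cexp_neg_mul_sq_norm_add (V := 𝔼) (b := (1/2 : ℂ)) (by norm_num) Complex.I t
  have : ∀ x : 𝔼, Real.toNNReal (gconst d * gdens x) • Complex.exp (inner ℝ x t * Complex.I)
      = (gconst d : ℂ) * Complex.exp (-(1/2 : ℂ) * ‖x‖ ^ 2 + Complex.I * inner ℝ t x) := by
    intro x
    rw [NNReal.smul_def, Real.coe_toNNReal _ (mul_nonneg gconst_pos.le (gdens_nonneg _)),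
      Complex.real_smul, Complex.exp_add, gdens, real_inner_comm x t]
    push_cast
    rw [mul_comm Complex.I]
    ring
  simp_rw [this]
  rw [integral_const_mul, h, gconst]
  have h2 : ((Real.pi : ℂ) / (1/2)) ^ ((Module.finrank ℝ 𝔼 : ℂ) / 2)
      = (((2 * Real.pi) ^ ((d : ℝ) / 2) : ℝ) : ℂ) := by
    rw [Complex.ofReal_cpow (by positivity)]
    simp
    congr 1
    ring
  rw [h2, ← mul_assoc, ← Complex.ofReal_mul, inv_mul_cancel₀ (by positivity)]
  simp
  congr 1
  ring

lemma gauss_integral (φ : 𝔼 → ℝ) :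
    ∫ x, φ x ∂(stdGaussian 𝔼) = gconst d * ∫ x, φ x * gdens x := by
  have hm : Measurable (fun x : 𝔼 => Real.toNNReal (gconst d * gdens x)) :=
    ((gdens_cont.measurable).const_mul _).real_toNNReal
  rw [stdGaussian_eq_dens, integral_withDensity_eq_integral_smul hm, ← integral_const_mul]
  congr 1; ext x
  rw [NNReal.smul_def, Real.coe_toNNReal _ (mul_nonneg gconst_pos.le (gdens_nonneg _)), smul_eq_mul]
  ring

lemma gauss_integrable {φ : 𝔼 → ℝ} (h : Integrable φ (stdGaussian 𝔼)) :
    Integrable (fun x => φ x * gdens x) volume := by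
  have hm : Measurable (fun x : 𝔼 => Real.toNNReal (gconst d * gdens x)) :=
    ((gdens_cont.measurable).const_mul _).real_toNNReal
  rw [stdGaussian_eq_dens, integrable_withDensity_iff_integrable_smul hm] at h
  refine (h.const_mul (gconst d)⁻¹).congr (Eventually.of_forall fun x => ?_)
  simp only [NNReal.smul_def, Real.coe_toNNReal _ (mul_nonneg gconst_pos.le (gdens_nonneg _)), smul_eq_mul]
  have := (gconst_pos (d := d)).ne'
  field_simp

lemma gdens_hasFDerivAt (x : 𝔼) : HasFDerivAt (gdens (d := d)) (-(gdens x) • innerSL ℝ x) x := by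
  unfold gdens
  have h := ((hasStrictFDerivAt_norm_sq x).hasFDerivAt.const_mul (-(1/2 : ℝ))).exp
  refine h.congr_fderiv ?_
  ext v; simp

lemma stein (h : 𝔼 → ℝ) (hh : ContDiff ℝ 1 h) (B M : ℝ) (hB : ∀ x, |h x| ≤ B)
    (hM : ∀ x, ‖fderiv ℝ h x‖ ≤ M) (w : 𝔼) :
    ∫ v, h v * inner ℝ w v ∂(stdGaussian 𝔼) = ∫ v, fderiv ℝ h v w ∂(stdGaussian 𝔼) := by
  have hint0 : Integrable (fun v : 𝔼 => ‖v‖) (stdGaussian 𝔼) := IsGaussian.integrable_id.norm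
  have hc' := hh.continuous_fderiv (by norm_num)
  have hc := hh.continuous
  have i1 : Integrable h (stdGaussian 𝔼) :=
    Integrable.of_bound hc.aestronglyMeasurable B (Eventually.of_forall hB)
  have i2 : Integrable (fun v => fderiv ℝ h v w) (stdGaussian 𝔼) := by
    refine Integrable.of_bound (by fun_prop) (M * ‖w‖) (Eventually.of_forall fun v => ?_)
    exact (fderiv ℝ h v).le_of_opNorm_le (hM v) w
  have i3 : Integrable (fun v => h v * inner ℝ w v) (stdGaussian 𝔼) := by
    refine (hint0.const_mul (B * ‖w‖)).mono' (by fun_prop) (Eventually.of_forall fun v => ?_)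
    rw [norm_mul, mul_assoc]
    gcongr
    · exact (abs_nonneg _).trans (hB 0)
    · exact hB v
    · exact norm_inner_le_norm w v
  have hfd : ∀ x, fderiv ℝ (gdens (d := d)) x w = -(inner ℝ w x * gdens x) := by
    intro x
    rw [(gdens_hasFDerivAt x).fderiv]
    simp [real_inner_comm]
    ring
  have key := integral_mul_fderiv_eq_neg_fderiv_mul_of_integrable (μ := (volume : Measure 𝔼))
    (f := h) (g := gdens) (v := w) (gauss_integrable i2)
    (by
      refine (gauss_integrable i3).neg.congr (Eventually.of_forall fun v => ?_)
      simp only [hfd, Pi.neg_apply]; ring)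
    (gauss_integrable i1) (fun x _ => (hh.differentiable (by norm_num)) x)
    (fun x _ => (gdens_hasFDerivAt x).differentiableAt)
  rw [gauss_integral, gauss_integral]
  congr 1
  simp_rw [hfd, mul_neg, integral_neg] at key
  rw [← neg_inj.1 key]
  congr 1; ext; ring

lemma gauss_cov (g G : 𝔼 → ℝ) (hg : ContDiff ℝ 1 g) (hG : ContDiff ℝ 1 G) (B B' L M : ℝ)
    (hB : ∀ x, |g x| ≤ B) (hB' : ∀ x, |G x| ≤ B') (hL : ∀ x, ‖fderiv ℝ g x‖ ≤ L)
    (hM : ∀ x, ‖fderiv ℝ G x‖ ≤ M) :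
    ∫ x, g x * G x ∂(stdGaussian 𝔼) - (∫ x, g x ∂(stdGaussian 𝔼)) * ∫ x, G x ∂(stdGaussian 𝔼)
      ≤ L * ∫ x, ‖fderiv ℝ G x‖ ∂(stdGaussian 𝔼) := by
  set γ := stdGaussian 𝔼 with hγ
  have hB0 : 0 ≤ B := (abs_nonneg _).trans (hB 0)
  have hL0 : 0 ≤ L := (norm_nonneg _).trans (hL 0)
  have hM0 : 0 ≤ M := (norm_nonneg _).trans (hM 0)
  have hint0 : Integrable (fun v : 𝔼 => ‖v‖) γ := IsGaussian.integrable_id.norm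
  have hgc := hg.continuous
  have hGc := hG.continuous
  have hgc' := hg.continuous_fderiv (by norm_num)
  have hGc' := hG.continuous_fderiv (by norm_num)
  have hgd := hg.differentiable (by norm_num)
  have hGd := hG.differentiable (by norm_num)
  have hi1 : Integrable (fun p : 𝔼 × 𝔼 => ‖p.1‖) (γ.prod γ) := hint0.comp_fst γ
  have hi2 : Integrable (fun p : 𝔼 × 𝔼 => ‖p.2‖) (γ.prod γ) := hint0.comp_snd γ
  have happ : Continuous (fun p : (𝔼 →L[ℝ] ℝ) × 𝔼 => p.1 p.2) := by fun_prop
  let F : ℝ → 𝔼 × 𝔼 → ℝ := fun θ p => g p.1 * G (Real.cos θ • p.1 + Real.sin θ • p.2)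
  let F' : ℝ → 𝔼 × 𝔼 → ℝ := fun θ p => g p.1 *
    fderiv ℝ G (Real.cos θ • p.1 + Real.sin θ • p.2) (-Real.sin θ • p.1 + Real.cos θ • p.2)
  have hder : ∀ θ, HasDerivAt (fun θ => ∫ p, F θ p ∂(γ.prod γ)) (∫ p, F' θ p ∂(γ.prod γ)) θ := by
    intro θ
    refine (hasDerivAt_integral_of_dominated_loc_of_deriv_le (s := Set.univ) (F' := F')
      (bound := fun p => B * (M * (‖p.1‖ + ‖p.2‖))) Filter.univ_mem ?_ ?_ ?_ ?_ ?_ ?_).2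
    · refine Eventually.of_forall fun t => ?_
      have : Continuous (F t) := by simp only [F]; fun_prop
      exact this.aestronglyMeasurable
    · refine Integrable.of_bound (C := B * B') ?_ (Eventually.of_forall fun p => ?_)
      · have : Continuous (F θ) := by simp only [F]; fun_prop
        exact this.aestronglyMeasurable
      · simp only [F]
        rw [norm_mul]
        gcongr
        · exact hB _
        · exact hB' _
    · have : Continuous (F' θ) := by simp only [F']; fun_prop
      exact this.aestronglyMeasurable
    · refine Eventually.of_forall fun p t _ => ?_
      simp only [F']
      rw [norm_mul]
      gcongr
      · exact hB _
      · refine (ContinuousLinearMap.le_of_opNorm_le _ (hM _) _).trans ?_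
        gcongr
        refine (norm_add_le _ _).trans ?_
        rw [norm_smul, norm_smul]
        gcongr
        · refine mul_le_of_le_one_left (norm_nonneg _) ?_
          rw [norm_neg]; exact Real.abs_sin_le_one t
        · refine mul_le_of_le_one_left (norm_nonneg _) ?_
          exact Real.abs_cos_le_one t
    · exact ((hi1.add hi2).const_mul M).const_mul B
    · refine Eventually.of_forall fun p t _ => ?_
      have h1 : HasDerivAt (fun t => Real.cos t • p.1 + Real.sin t • p.2)
          (-Real.sin t • p.1 + Real.cos t • p.2) t :=
        ((Real.hasDerivAt_cos t).smul_const p.1).add ((Real.hasDerivAt_sin t).smul_const p.2)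
      exact ((hGd _).hasFDerivAt.comp_hasDerivAt t h1).const_mul (g p.1)
  set A : ℝ := L * ∫ x, ‖fderiv ℝ G x‖ ∂γ with hA
  have hlow : ∀ θ, 0 ≤ Real.sin θ → - (Real.sin θ * A) ≤ ∫ p, F' θ p ∂(γ.prod γ) := by
    intro θ hs
    let Ψ : 𝔼 × 𝔼 → ℝ := fun q => g (Real.cos θ • q.1 - Real.sin θ • q.2) * fderiv ℝ G q.1 q.2
    have hΨc : Continuous Ψ := by simp only [Ψ]; fun_prop
    have e1 : ∀ p, F' θ p = Ψ (ContinuousLinearMap.rotation θ p) := by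
      intro p
      simp only [F', Ψ, ContinuousLinearMap.rotation_apply]
      congr 2
      have := Real.cos_sq_add_sin_sq θ
      calc p.1 = (Real.cos θ ^ 2 + Real.sin θ ^ 2) • p.1 := by rw [this, one_smul]
        _ = _ := by module
    have e2 : ∫ p, F' θ p ∂(γ.prod γ) = ∫ p, Ψ p ∂(γ.prod γ) := by
      simp_rw [e1]
      rw [← integral_map (φ := ContinuousLinearMap.rotation θ) (by fun_prop)
        hΨc.aestronglyMeasurable,
        IsGaussian.map_rotation_eq_self (by simp [hγ])]
    have hΨi : Integrable Ψ (γ.prod γ) := by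
      refine ((hi2.const_mul M).const_mul B).mono' hΨc.aestronglyMeasurable
        (Eventually.of_forall fun p => ?_)
      simp only [Ψ]
      rw [norm_mul]
      gcongr
      · exact hB _
      · exact ContinuousLinearMap.le_of_opNorm_le _ (hM _) _
    rw [e2, integral_prod _ hΨi]
    have e3 : ∀ u, -(Real.sin θ * (L * ‖fderiv ℝ G u‖)) ≤ ∫ v, Ψ (u, v) ∂γ := by
      intro u
      set w : 𝔼 := (InnerProductSpace.toDual ℝ 𝔼).symm (fderiv ℝ G u) with hw
      have hwn : ‖w‖ = ‖fderiv ℝ G u‖ := by rw [hw, LinearIsometryEquiv.norm_map]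
      have hwi : ∀ v, inner ℝ w v = fderiv ℝ G u v := fun v => by
        rw [hw, InnerProductSpace.toDual_symm_apply]
      let h : 𝔼 → ℝ := fun v => g (Real.cos θ • u - Real.sin θ • v)
      have hh : ContDiff ℝ 1 h := by
        refine hg.comp ?_
        fun_prop
      have hfd : ∀ v, fderiv ℝ h v =
          -Real.sin θ • fderiv ℝ g (Real.cos θ • u - Real.sin θ • v) := by
        intro v
        have h1 : HasFDerivAt (fun v : 𝔼 => Real.cos θ • u - Real.sin θ • v)
            (-(Real.sin θ • ContinuousLinearMap.id ℝ 𝔼)) v :=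
          ((hasFDerivAt_id v).const_smul (Real.sin θ)).const_sub _
        have h2 : HasFDerivAt h _ v := (hgd _).hasFDerivAt.comp v h1
        rw [h2.fderiv]
        ext z; simp
      have hle : ∀ v, ‖fderiv ℝ h v‖ ≤ Real.sin θ * L := by
        intro v
        rw [hfd, norm_smul, norm_neg, Real.norm_of_nonneg hs]
        gcongr
        exact hL _
      have hst := stein h hh B (Real.sin θ * L) (fun v => hB _) hle w
      have e4 : ∫ v, Ψ (u, v) ∂γ = ∫ v, fderiv ℝ h v w ∂γ := by
        rw [← hst]
        simp only [Ψ, h, hwi]; rfl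
      rw [e4]
      have hc := hh.continuous_fderiv (by norm_num)
      have e5 : ∫ v, -(Real.sin θ * (L * ‖fderiv ℝ G u‖)) ∂γ ≤ ∫ v, fderiv ℝ h v w ∂γ := by
        refine integral_mono (integrable_const _) ?_ fun v => ?_
        · refine Integrable.of_bound (by fun_prop) (Real.sin θ * L * ‖w‖)
            (Eventually.of_forall fun v => ?_)
          exact ContinuousLinearMap.le_of_opNorm_le _ (hle v) w
        · have := ContinuousLinearMap.le_of_opNorm_le _ (hle v) w
          rw [hwn, mul_assoc] at this
          exact (abs_le.1 this).1
      simpa using e5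
    calc -(Real.sin θ * A) = ∫ u, -(Real.sin θ * (L * ‖fderiv ℝ G u‖)) ∂γ := by
          rw [integral_neg, integral_const_mul, integral_const_mul]
      _ ≤ _ := by
          refine integral_mono ?_ hΨi.integral_prod_left e3
          refine Integrable.neg (Integrable.const_mul (Integrable.const_mul ?_ _) _)
          refine Integrable.of_bound (by fun_prop) M (Eventually.of_forall fun v => ?_)
          rw [norm_norm]; exact hM v
  have hmono : MonotoneOn (fun θ => ∫ p, F θ p ∂(γ.prod γ) - Real.cos θ * A)
      (Set.Icc 0 (Real.pi / 2)) := by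
    have hd2 : ∀ θ, HasDerivAt (fun θ => ∫ p, F θ p ∂(γ.prod γ) - Real.cos θ * A)
        (∫ p, F' θ p ∂(γ.prod γ) - (-Real.sin θ) * A) θ :=
      fun θ => (hder θ).sub ((Real.hasDerivAt_cos θ).mul_const A)
    refine monotoneOn_of_deriv_nonneg (convex_Icc _ _)
      (fun θ _ => (hd2 θ).continuousAt.continuousWithinAt)
      (fun θ _ => (hd2 θ).differentiableAt.differentiableWithinAt) fun θ hθ => ?_
    rw [interior_Icc] at hθ
    rw [(hd2 θ).deriv]
    have := hlow θ (Real.sin_nonneg_of_nonneg_of_le_pi hθ.1.le (by linarith [hθ.2, Real.pi_pos]))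
    linarith
  have hfin := hmono (Set.left_mem_Icc.2 (by positivity)) (Set.right_mem_Icc.2 (by positivity))
    (by positivity)
  simp only [F, Real.cos_zero, Real.sin_zero, one_smul, zero_smul, add_zero, one_mul,
    Real.cos_pi_div_two, Real.sin_pi_div_two, zero_add, zero_mul, sub_zero] at hfin
  rw [integral_prod_mul, integral_fun_fst (fun x => g x * G x)] at hfin
  simp at hfin
  linarith

lemma gauss_mgf (g : 𝔼 → ℝ) (hg : ContDiff ℝ 1 g) (B L : ℝ)
    (hB : ∀ x, |g x| ≤ B) (hL : ∀ x, ‖fderiv ℝ g x‖ ≤ L) (t : ℝ) (ht : 0 ≤ t) :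
    mgf g (stdGaussian 𝔼) t ≤
      Real.exp (t * (∫ x, g x ∂(stdGaussian 𝔼)) + t ^ 2 * L ^ 2 / 2) := by
  set γ := stdGaussian 𝔼 with hγ
  set c := ∫ x, g x ∂γ with hc
  have hL0 : 0 ≤ L := (norm_nonneg _).trans (hL 0)
  have hB0 : 0 ≤ B := (abs_nonneg _).trans (hB 0)
  have hset : ∀ s, Integrable (fun x => Real.exp (s * g x)) γ := fun s =>
    integrable_exp_mul_of_mem_Icc (a := -B) (b := B) hg.continuous.aemeasurable
      (Eventually.of_forall fun x => abs_le.1 (hB x))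
  have huniv : integrableExpSet g γ = Set.univ := by
    ext s; simp [integrableExpSet, hset s]
  have hd : ∀ s, HasDerivAt (mgf g γ) (∫ x, g x * Real.exp (s * g x) ∂γ) s := fun s =>
    hasDerivAt_mgf (by simp [huniv])
  have hineq : ∀ s, 0 ≤ s → ∫ x, g x * Real.exp (s * g x) ∂γ ≤ (c + s * L ^ 2) * mgf g γ s := by
    intro s hs
    have hGf : ∀ x, fderiv ℝ (fun x => Real.exp (s * g x)) x
        = Real.exp (s * g x) • (s • fderiv ℝ g x) := fun x =>
      (((hg.differentiable (by norm_num) x).hasFDerivAt.const_mul s).exp).fderiv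
    have hGn : ∀ x, ‖fderiv ℝ (fun x => Real.exp (s * g x)) x‖ ≤ s * L * Real.exp (s * g x) := by
      intro x
      rw [hGf, norm_smul, norm_smul, Real.norm_of_nonneg hs,
        Real.norm_of_nonneg (Real.exp_nonneg _), mul_comm]
      gcongr
      exact hL x
    have hle : ∀ x, Real.exp (s * g x) ≤ Real.exp (s * B) := fun x => by
      gcongr; exact (abs_le.1 (hB x)).2
    have hGC : ContDiff ℝ 1 (fun x => Real.exp (s * g x)) := by fun_prop
    have := gauss_cov g (fun x => Real.exp (s * g x)) hg hGC
      B (Real.exp (s * B)) L (s * L * Real.exp (s * B)) hB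
      (fun x => by rw [abs_of_nonneg (Real.exp_nonneg _)]; exact hle x) hL
      (fun x => (hGn x).trans (by gcongr; exact (abs_le.1 (hB x)).2))
    have h2 : ∫ x, ‖fderiv ℝ (fun x => Real.exp (s * g x)) x‖ ∂γ ≤ s * L * mgf g γ s := by
      rw [mgf, ← integral_const_mul]
      refine integral_mono ?_ ((hset s).const_mul _) hGn
      have := hGC.continuous_fderiv (by norm_num)
      exact ((hset s).const_mul _).mono' (by fun_prop)
        (Eventually.of_forall fun x => by rw [norm_norm]; exact hGn x)
    have h3 := mul_le_mul_of_nonneg_left h2 hL0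
    have h4 : mgf g γ s = ∫ x, Real.exp (s * g x) ∂γ := rfl
    rw [← h4, ← hc] at this
    nlinarith
  have hanti : AntitoneOn (fun s => mgf g γ s * Real.exp (-(s * c + s ^ 2 * L ^ 2 / 2)))
      (Set.Ici 0) := by
    have hd2 : ∀ s, HasDerivAt (fun s => mgf g γ s * Real.exp (-(s * c + s ^ 2 * L ^ 2 / 2)))
        ((∫ x, g x * Real.exp (s * g x) ∂γ - (c + s * L ^ 2) * mgf g γ s)
          * Real.exp (-(s * c + s ^ 2 * L ^ 2 / 2))) s := by
      intro s
      have h1 : HasDerivAt (fun s : ℝ => -(s * c + s ^ 2 * L ^ 2 / 2)) (-(c + s * L ^ 2)) s := by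
        have := (((hasDerivAt_id s).mul_const c).add
          ((((hasDerivAt_id s).pow 2).mul_const (L ^ 2)).div_const 2)).neg
        refine this.congr_deriv ?_
        simp; ring
      refine ((hd s).mul h1.exp).congr_deriv ?_
      ring
    refine antitoneOn_of_deriv_nonpos (convex_Ici _)
      (fun θ _ => (hd2 θ).continuousAt.continuousWithinAt)
      (fun θ _ => (hd2 θ).differentiableAt.differentiableWithinAt) fun s hs => ?_
    rw [interior_Ici] at hs
    rw [(hd2 s).deriv]
    exact mul_nonpos_of_nonpos_of_nonneg (sub_nonpos.2 (hineq s (le_of_lt hs))) (Real.exp_nonneg _)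
  have := hanti (Set.mem_Ici.2 le_rfl) (Set.mem_Ici.2 ht) ht
  simp at this
  rw [← neg_add_rev, add_comm, Real.exp_neg, ← div_eq_mul_inv, div_le_one (Real.exp_pos _)] at this
  first | exact this | (rw [add_comm]; exact this)

lemma gauss_tail_smooth (g : 𝔼 → ℝ) (hg : ContDiff ℝ 1 g) (B L : ℝ) (hLp : 0 < L)
    (hB : ∀ x, |g x| ≤ B) (hL : ∀ x, ‖fderiv ℝ g x‖ ≤ L) (x : ℝ)
    (hx : ∫ y, g y ∂(stdGaussian 𝔼) ≤ x) :
    (stdGaussian 𝔼).real {y | x ≤ g y} ≤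
      Real.exp (-(x - ∫ y, g y ∂(stdGaussian 𝔼)) ^ 2 / (2 * L ^ 2)) := by
  set c := ∫ y, g y ∂(stdGaussian 𝔼) with hc
  have ht : 0 ≤ (x - c) / L ^ 2 := div_nonneg (sub_nonneg.2 hx) (by positivity)
  have h1 := measure_ge_le_exp_mul_mgf (μ := stdGaussian 𝔼) (X := g) x ht
    (integrable_exp_mul_of_mem_Icc (a := -B) (b := B) hg.continuous.aemeasurable
      (Eventually.of_forall fun x => abs_le.1 (hB x)))
  have h2 := gauss_mgf g hg B L hB hL _ ht
  refine h1.trans ((mul_le_mul_of_nonneg_left h2 (Real.exp_nonneg _)).trans ?_)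
  rw [← Real.exp_add, ← hc]
  apply le_of_eq
  congr 1
  field_simp
  ring

lemma mollify (g : 𝔼 → ℝ) (L : NNReal) (hg : LipschitzWith L g) (δ : ℝ) (hδ : 0 < δ) :
    ∃ g' : 𝔼 → ℝ, ContDiff ℝ 1 g' ∧ (∀ x, ‖fderiv ℝ g' x‖ ≤ L) ∧ ∀ x, |g' x - g x| ≤ δ := by
  have hr : 0 < δ / (L + 1) := by positivity
  let φ : ContDiffBump (0 : 𝔼) := ⟨δ / (L + 1) / 2, δ / (L + 1), by positivity, by linarith⟩
  let g' : 𝔼 → ℝ := convolution (φ.normed volume) g (ContinuousLinearMap.lsmul ℝ ℝ) volume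
  have hgc := hg.continuous
  have hg' : ∀ x, g' x = ∫ t, φ.normed volume t * g (x - t) := fun x => rfl
  have hi : ∀ x, Integrable (fun t => φ.normed volume t * g (x - t)) volume := fun x => by
    have h1 : Continuous (fun t => φ.normed volume t * g (x - t)) := by
      have := φ.continuous_normed (μ := volume)
      fun_prop
    exact h1.integrable_of_hasCompactSupport (φ.hasCompactSupport_normed.mul_right)
  refine ⟨g', ?_, ?_, ?_⟩
  · exact φ.hasCompactSupport_normed.contDiff_convolution_left _ φ.contDiff_normed
      hgc.locallyIntegrable
  · have hl : LipschitzWith L g' := by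
      refine LipschitzWith.of_dist_le_mul fun x y => ?_
      rw [hg', hg', dist_eq_norm, ← integral_sub (hi x) (hi y)]
      calc _ ≤ ∫ t, φ.normed volume t * (L * dist x y) := by
            refine norm_integral_le_of_norm_le (φ.integrable_normed.mul_const _)
              (Eventually.of_forall fun t => ?_)
            rw [← mul_sub, norm_mul, Real.norm_of_nonneg (φ.nonneg_normed t), ← dist_eq_norm]
            refine mul_le_mul_of_nonneg_left ?_ (φ.nonneg_normed t)
            simpa using hg.dist_le_mul (x - t) (y - t)
        _ = _ := by rw [integral_mul_const, φ.integral_normed, one_mul]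
    exact fun x => norm_fderiv_le_of_lipschitz ℝ hl
  · intro x
    have := φ.dist_normed_convolution_le (μ := volume) (g := g) (x₀ := x) (ε := δ)
      hgc.aestronglyMeasurable (fun y hy => ?_)
    · exact this
    · refine (hg.dist_le_mul y x).trans ?_
      have h1 : dist y x < δ / (L + 1) := hy
      calc (L : ℝ) * dist y x ≤ (L + 1) * (δ / (L + 1)) := by
            gcongr; linarith
        _ = δ := by field_simp

lemma gauss_tail_bdd (g : 𝔼 → ℝ) (L : NNReal) (hLp : 0 < L) (hg : LipschitzWith L g) (B : ℝ)
    (hB : ∀ x, |g x| ≤ B) (x : ℝ) (hx : ∫ y, g y ∂(stdGaussian 𝔼) < x) :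
    (stdGaussian 𝔼).real {y | x ≤ g y} ≤
      Real.exp (-(x - ∫ y, g y ∂(stdGaussian 𝔼)) ^ 2 / (2 * L ^ 2)) := by
  set c := ∫ y, g y ∂(stdGaussian 𝔼) with hc
  have hgi : Integrable g (stdGaussian 𝔼) :=
    Integrable.of_bound hg.continuous.aestronglyMeasurable B (Eventually.of_forall hB)
  have hlim : Tendsto (fun δ : ℝ => Real.exp (-(x - 2 * δ - c) ^ 2 / (2 * (L : ℝ) ^ 2))) (𝓝[>] 0)
      (𝓝 (Real.exp (-(x - 2 * 0 - c) ^ 2 / (2 * (L : ℝ) ^ 2)))) := by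
    refine tendsto_nhdsWithin_of_tendsto_nhds (Continuous.tendsto ?_ 0)
    fun_prop
  rw [mul_zero, sub_zero] at hlim
  refine ge_of_tendsto hlim ?_
  filter_upwards [Ioo_mem_nhdsGT (show (0:ℝ) < (x - c) / 2 by linarith)] with δ hδ
  obtain ⟨g', h1, h2, h3⟩ := mollify g L hg δ hδ.1
  have hb' : ∀ y, |g' y| ≤ B + δ := fun y => by
    have := abs_le.1 (h3 y); have := abs_le.1 (hB y)
    exact abs_le.2 ⟨by linarith, by linarith⟩
  have hgi' : Integrable g' (stdGaussian 𝔼) :=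
    Integrable.of_bound h1.continuous.aestronglyMeasurable (B + δ) (Eventually.of_forall hb')
  have hc' : ∫ y, g' y ∂(stdGaussian 𝔼) ≤ c + δ := by
    have : ∫ y, g' y ∂(stdGaussian 𝔼) ≤ ∫ y, (g y + δ) ∂(stdGaussian 𝔼) :=
      integral_mono hgi' (hgi.add (integrable_const δ)) fun y => by
        have := abs_le.1 (h3 y)
        show g' y ≤ g y + δ
        linarith
    rw [integral_add hgi (integrable_const δ)] at this
    simpa using this
  have hd := hδ.2
  have ht := gauss_tail_smooth g' h1 (B + δ) L hLp hb' h2 (x - δ) (by linarith)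
  refine (measureReal_mono (fun y hy => ?_)).trans (ht.trans ?_)
  · have := abs_le.1 (h3 y)
    change x ≤ g y at hy
    change x - δ ≤ g' y
    linarith
  · rw [Real.exp_le_exp]
    have hsq : (x - 2 * δ - c) ^ 2 ≤ (x - δ - ∫ y, g' y ∂(stdGaussian 𝔼)) ^ 2 :=
      pow_le_pow_left₀ (by linarith) (by linarith) 2
    exact div_le_div_of_nonneg_right (neg_le_neg hsq) (by positivity)

lemma gauss_tail (g : 𝔼 → ℝ) (L : NNReal) (hLp : 0 < L) (hg : LipschitzWith L g)
    (x : ℝ) (hx : ∫ y, g y ∂(stdGaussian 𝔼) < x) :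
    (stdGaussian 𝔼).real {y | x ≤ g y} ≤
      Real.exp (-(x - ∫ y, g y ∂(stdGaussian 𝔼)) ^ 2 / (2 * L ^ 2)) := by
  set c := ∫ y, g y ∂(stdGaussian 𝔼) with hc
  have hgi : Integrable g (stdGaussian 𝔼) := by
    have hint0 : Integrable (fun v : 𝔼 => ‖v‖) (stdGaussian 𝔼) := IsGaussian.integrable_id.norm
    refine ((integrable_const |g 0|).add (hint0.const_mul L)).mono'
      hg.continuous.aestronglyMeasurable (Eventually.of_forall fun y => ?_)
    have := hg.dist_le_mul y 0
    rw [dist_zero_right, Real.dist_eq] at this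
    have h2 := abs_sub_abs_le_abs_sub (g y) (g 0)
    simp only [Pi.add_apply, Real.norm_eq_abs]
    linarith
  let gn : ℕ → 𝔼 → ℝ := fun n y => max (min (g y) n) (-n)
  have hl : ∀ n, LipschitzWith L (gn n) := fun n => (hg.min_const n).max_const (-n)
  have hbn : ∀ n y, |gn n y| ≤ n := fun n y => by
    refine abs_le.2 ⟨le_max_right _ _, max_le (min_le_right _ _) ?_⟩
    have : (0:ℝ) ≤ n := n.cast_nonneg
    linarith
  have hbg : ∀ n y, |gn n y| ≤ |g y| := fun n y => by
    have hn : (0:ℝ) ≤ n := n.cast_nonneg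
    refine abs_le.2 ⟨?_, max_le ((min_le_left _ _).trans (le_abs_self _)) (by linarith [abs_nonneg (g y)])⟩
    refine le_max_of_le_left (le_min (neg_abs_le _) (by linarith [abs_nonneg (g y)]))
  have hcn : Tendsto (fun n => ∫ y, gn n y ∂(stdGaussian 𝔼)) atTop (𝓝 c) := by
    refine tendsto_integral_of_dominated_convergence (fun y => |g y|)
      (fun n => (hl n).continuous.aestronglyMeasurable) hgi.abs
      (fun n => Eventually.of_forall (hbg n)) (Eventually.of_forall fun y => ?_)
    refine tendsto_const_nhds.congr' ?_
    filter_upwards [eventually_ge_atTop ⌈|g y|⌉₊] with n hn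
    have h1 : |g y| ≤ n := (Nat.le_ceil _).trans (by exact_mod_cast hn)
    have h2 := abs_le.1 h1
    simp only [gn]
    rw [min_eq_left h2.2, max_eq_left h2.1]
  have hlim : Tendsto (fun n => Real.exp (-(x - ∫ y, gn n y ∂(stdGaussian 𝔼)) ^ 2 / (2 * (L:ℝ) ^ 2)))
      atTop (𝓝 (Real.exp (-(x - c) ^ 2 / (2 * (L:ℝ) ^ 2)))) := by
    have : Continuous (fun c : ℝ => Real.exp (-(x - c) ^ 2 / (2 * (L:ℝ) ^ 2))) := by fun_prop
    exact (this.tendsto c).comp hcn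
  refine ge_of_tendsto hlim ?_
  filter_upwards [hcn.eventually_lt_const hx, eventually_ge_atTop ⌈x⌉₊] with n hn1 hn2
  have h1 : x ≤ n := (Nat.le_ceil _).trans (by exact_mod_cast hn2)
  refine (measureReal_mono (fun y hy => ?_)).trans (gauss_tail_bdd (gn n) L hLp (hl n) n (hbn n) x hn1)
  exact le_max_of_le_left (le_min hy h1)

end Gauss

/-- Gaussian concentration: if `X ~ N(m, S)` and `f` is Lipschitz with `E f(X) = 0` and
`⟨∇f, Σ∇f⟩ ≤ K` wherever `f` is differentiable (`K` bounding `‖Σ^{1/2}∇f‖²_∞`), then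
`P(f(X) ≥ x) ≤ exp(-x²/(2K))` for all `x > 0`. -/
theorem stmt0 {d : ℕ} (P : Measure (EuclideanSpace ℝ (Fin d)))
    (m : EuclideanSpace ℝ (Fin d)) (S : Matrix (Fin d) (Fin d) ℝ)
    (hP : IsGaussianMeasure P m S) (hS : S.IsSymm) (hpsd : S.PosSemidef)
    (f : EuclideanSpace ℝ (Fin d) → ℝ) (C : NNReal) (hf : LipschitzWith C f)
    (hmean : ∫ y, f y ∂P = 0) (K : ℝ) (hK : 0 < K)
    (hgrad : ∀ y, DifferentiableAt ℝ f y →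
      ∑ i, ∑ j, S i j * gradient f y i * gradient f y j ≤ K)
    (x : ℝ) (hx : 0 < x) :
    (P {y | x ≤ f y}).toReal ≤ Real.exp (-x ^ 2 / (2 * K)) := by
  have hprob := hP.1
  have hPeq : P = multivariateGaussian m S := by
    refine Measure.ext_of_charFun ?_
    ext t
    rw [charFun_multivariateGaussian hpsd, charFun_apply]
    have h := hP.2 t
    have e1 : ∀ y : EuclideanSpace ℝ (Fin d), (inner ℝ y t : ℝ) = ∑ i, t i * y i := fun y => by
      simp [PiLp.inner_apply]
    have e2 : (inner ℝ t m : ℝ) = ∑ i, m i * t i := by simp [PiLp.inner_apply]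
    have e3 : t.ofLp ⬝ᵥ S.mulVec t.ofLp = ∑ i, ∑ j, S i j * t i * t j := by
      simp only [dotProduct, Matrix.mulVec, Finset.mul_sum]
      refine Finset.sum_congr rfl fun i _ => Finset.sum_congr rfl fun j _ => by ring
    simp_rw [e1]
    rw [e2, e3, mul_comm _ Complex.I, ← h]
    congr 1; ext y; rw [mul_comm]
  set R := Matrix.toEuclideanCLM (𝕜 := ℝ) (CFC.sqrt S) with hR
  have hRsq : ∀ z, R (R z) = Matrix.toEuclideanCLM (𝕜 := ℝ) S z := by
    intro z
    have : CFC.sqrt S * CFC.sqrt S = S := CFC.sqrt_mul_sqrt_self S hpsd.nonneg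
    rw [← ContinuousLinearMap.mul_apply, hR, ← map_mul, this]
  have hRsa : ∀ u z, (inner ℝ (R u) z : ℝ) = inner ℝ u (R z) := by
    have h1 : IsSelfAdjoint (CFC.sqrt S) := (CFC.sqrt_nonneg S).isSelfAdjoint
    have h2 : IsSelfAdjoint R := h1.map _
    intro u z
    rw [← ContinuousLinearMap.adjoint_inner_right, ContinuousLinearMap.isSelfAdjoint_iff'.1 h2]
  have hdir : ∀ u y, DifferentiableAt ℝ f y → fderiv ℝ f y (R u) ≤ Real.sqrt K * ‖u‖ := by
    intro u y hy
    have h1 : fderiv ℝ f y (R u) = inner ℝ (gradient f y) (R u) := by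
      rw [gradient, InnerProductSpace.toDual_symm_apply]
    have h2 : ‖R (gradient f y)‖ ^ 2 ≤ K := by
      rw [← real_inner_self_eq_norm_sq, hRsa, hRsq]
      refine le_trans (le_of_eq ?_) (hgrad y hy)
      simp only [PiLp.inner_apply, Matrix.ofLp_toEuclideanCLM, Matrix.mulVec, dotProduct]
      simp only [RCLike.inner_apply, conj_trivial, Finset.sum_mul]
      refine Finset.sum_congr rfl fun i _ => Finset.sum_congr rfl fun j _ => by ring
    rw [h1, ← hRsa]
    refine (real_inner_le_norm _ _).trans ?_
    gcongr
    exact Real.le_sqrt_of_sq_le h2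
  let g : EuclideanSpace ℝ (Fin d) → ℝ := fun z => f (m + R z)
  have hgl : LipschitzWith (Real.sqrt K).toNNReal g := by
    refine LipschitzWith.of_le_add_mul _ fun z z' => ?_
    have := dir_lip volume f C hf (R (z - z')) (Real.sqrt K * ‖z - z'‖) (hdir (z - z')) (m + R z')
    rw [add_assoc, ← map_add, add_sub_cancel] at this
    rw [Real.coe_toNNReal _ (Real.sqrt_nonneg _), dist_eq_norm]
    simp only [g]
    linarith
  have hcont := hf.continuous
  have hmap : P = (stdGaussian (EuclideanSpace ℝ (Fin d))).map (fun z => m + R z) := hPeq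
  have hg0 : ∫ z, g z ∂(stdGaussian (EuclideanSpace ℝ (Fin d))) = 0 := by
    rw [← hmean, hmap, integral_map (by fun_prop) hcont.aestronglyMeasurable]
  have hms : MeasurableSet {y | x ≤ f y} := (isClosed_le continuous_const hcont).measurableSet
  have hfin := gauss_tail g _ (Real.toNNReal_pos.2 (Real.sqrt_pos.2 hK)) hgl x (by rw [hg0]; exact hx)
  rw [hg0, sub_zero, Real.coe_toNNReal _ (Real.sqrt_nonneg _), Real.sq_sqrt hK.le] at hfin
  rw [hmap, Measure.map_apply (by fun_prop) hms]
  exact hfin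
end

section
/- If X ~ N(μ, Σ) on ℝ^d and f : ℝ^d → ℝ is bounded and Lipschitz with E f(X) = 0, then for all t ∈ ℝ, E[exp(t f(X))] ≤ exp(t² ‖Σ^{1/2}∇f‖²_∞ / 2). -/
open MeasureTheory Finset

set_option linter.all false

open ProbabilityTheory
open scoped MatrixOrder

namespace GaussAux

section General

variable {E : Type*} [NormedAddCommGroup E] [InnerProductSpace ℝ E] [FiniteDimensional ℝ E]
  [MeasurableSpace E] [BorelSpace E]

/-- bounded `C^{1,1}` functions with gradient bound `L` and gradient Lipschitz bound `B`. -/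
structure Cls (L B : ℝ) (h : E → ℝ) : Prop where
  diff : Differentiable ℝ h
  bd : ∃ M : ℝ, ∀ x, |h x| ≤ M
  nL : ∀ x, ‖fderiv ℝ h x‖ ≤ L
  nB : ∀ x y, ‖fderiv ℝ h x - fderiv ℝ h y‖ ≤ B * ‖x - y‖

lemma avg {Ω : Type*} [MeasurableSpace Ω] (ρ : Measure Ω) [IsProbabilityMeasure ρ]
    (T : Ω → E) (hT : Measurable T) (h : E → ℝ) (C : ℝ)
    (hC : ∀ x y, |h x - h y| ≤ C * ‖x - y‖) (hc : Continuous h)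
    (hb : ∃ M : ℝ, ∀ x, |h x| ≤ M) (x₀ : E)
    (hd : ∀ᵐ y ∂ρ, DifferentiableAt ℝ h (x₀ + T y)) :
    Integrable (fun y => fderiv ℝ h (x₀ + T y)) ρ ∧
    HasFDerivAt (fun x => ∫ y, h (x + T y) ∂ρ) (∫ y, fderiv ℝ h (x₀ + T y) ∂ρ) x₀ := by
  obtain ⟨M, hM⟩ := hb
  have hm : ∀ x, AEStronglyMeasurable (fun y => h (x + T y)) ρ := fun x =>
    (hc.measurable.comp (hT.const_add x)).aestronglyMeasurable
  refine hasFDerivAt_integral_of_dominated_loc_of_lip' (s := Set.univ) (bound := fun _ => C)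
    Filter.univ_mem (fun x _ => hm x) ?_ ?_ ?_ (integrable_const _) ?_
  · exact Integrable.of_bound (hm x₀) M (.of_forall fun y => hM _)
  · exact ((measurable_fderiv ℝ h).comp (hT.const_add x₀)).aestronglyMeasurable
  · refine .of_forall fun y x _ => ?_
    have := hC (x + T y) (x₀ + T y)
    simpa using this
  · filter_upwards [hd] with y hy
    exact (hasFDerivAt_comp_add_right (f := h) (T y)).2 hy.hasFDerivAt

lemma Cls.lip {L B : ℝ} {h : E → ℝ} (hh : Cls L B h) (x y : E) : |h x - h y| ≤ L * ‖x - y‖ := by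
  have := Convex.norm_image_sub_le_of_norm_fderiv_le (𝕜 := ℝ) (s := Set.univ) (f := h) (C := L)
    (fun x _ => hh.diff x) (fun x _ => hh.nL x) convex_univ (Set.mem_univ y) (Set.mem_univ x)
  simpa using this

lemma Cls.L_nonneg {L B : ℝ} {h : E → ℝ} (hh : Cls L B h) : 0 ≤ L :=
  (norm_nonneg _).trans (hh.nL 0)

lemma Cls.avg {L B : ℝ} {h : E → ℝ} (hh : Cls L B h) (ρ : Measure E) [IsProbabilityMeasure ρ] :
    Cls L B (fun x => ∫ y, h (x + y) ∂ρ) := by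
  have key := fun x₀ => GaussAux.avg ρ (fun y : E => y) measurable_id h L hh.lip hh.diff.continuous
    hh.bd x₀ (.of_forall fun y => hh.diff _)
  refine ⟨fun x => (key x).2.differentiableAt, ?_, ?_, ?_⟩
  · obtain ⟨M, hM⟩ := hh.bd
    refine ⟨M, fun x => ?_⟩
    have := norm_integral_le_of_norm_le_const (μ := ρ) (f := fun y => h (x + y)) (C := M)
      (.of_forall fun y => hM _)
    simpa using this
  · intro x
    rw [(key x).2.fderiv]
    have := norm_integral_le_of_norm_le_const (μ := ρ) (f := fun y => fderiv ℝ h (x + y)) (C := L)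
      (.of_forall fun y => hh.nL _)
    simpa using this
  · intro x x'
    rw [(key x).2.fderiv, (key x').2.fderiv, ← integral_sub (key x).1 (key x').1]
    have := norm_integral_le_of_norm_le_const (μ := ρ)
      (f := fun y => fderiv ℝ h (x + y) - fderiv ℝ h (x' + y)) (C := B * ‖x - x'‖)
      (.of_forall fun y => by simpa using hh.nB (x + y) (x' + y))
    simpa using this

lemma Cls.taylor {L B : ℝ} {h : E → ℝ} (hB : 0 ≤ B) (hh : Cls L B h) (x u : E) :
    |h (x + u) - h x - fderiv ℝ h x u| ≤ B * ‖u‖ ^ 2 := by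
  have := Convex.norm_image_sub_le_of_norm_fderiv_le' (𝕜 := ℝ) (s := Metric.closedBall x ‖u‖)
    (f := h) (C := B * ‖u‖) (φ := fderiv ℝ h x)
    (fun x _ => hh.diff x) (fun y hy => (hh.nB y x).trans (by
      rw [Metric.mem_closedBall, dist_eq_norm] at hy
      gcongr)) (convex_closedBall _ _) (x := x) (y := x + u) (by simp) (by simp)
  rw [Real.norm_eq_abs] at this
  simpa [pow_two, mul_assoc] using this

lemma exp_bound3 (x : ℝ) : Real.exp x ≤ 1 + x + x ^ 2 / 2 + |x| ^ 3 * Real.exp |x| := by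
  have := Complex.norm_exp_sub_sum_le_norm_mul_exp x 3
  have e : Complex.exp x - ∑ m ∈ Finset.range 3, (x : ℂ) ^ m / (m.factorial : ℂ)
      = ((Real.exp x - (1 + x + x ^ 2 / 2) : ℝ) : ℂ) := by
    simp [Finset.sum_range_succ, Nat.factorial]
  rw [e, Complex.norm_real, Complex.norm_real, Real.norm_eq_abs, Real.norm_eq_abs] at this
  have := (abs_le.1 this).2
  linarith

lemma integrable_exp_norm (c : ℝ) :
    Integrable (fun x => Real.exp (c * ‖x‖)) (stdGaussian E) := by
  obtain ⟨C, hC, hi⟩ := IsGaussian.exists_integrable_exp_sq (stdGaussian E)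
  refine (hi.const_mul (Real.exp (c ^ 2 / (4 * C)))).mono' (by fun_prop) (.of_forall fun x => ?_)
  rw [Real.norm_of_nonneg (Real.exp_pos _).le, ← Real.exp_add, Real.exp_le_exp]
  have : c ^ 2 / (4 * C) + C * ‖x‖ ^ 2 - c * ‖x‖ = (c - 2 * C * ‖x‖) ^ 2 / (4 * C) := by
    field_simp; ring
  have : 0 ≤ (c - 2 * C * ‖x‖) ^ 2 / (4 * C) := by positivity
  linarith

lemma cube_le (n : ℝ) (hn : 0 ≤ n) : n ^ 3 ≤ 6 * Real.exp n := by
  have := Real.pow_div_factorial_le_exp n hn 3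
  simp [Nat.factorial] at this
  linarith

lemma pointwise {L B r : ℝ} (hB : 0 ≤ B) (hr : 0 ≤ r) (hr1 : r ≤ 1) {h : E → ℝ} (hh : Cls L B h)
    (x z : E) :
    Real.exp (h (x + r • z) - h x) ≤ 1 + (h (x + r • z) - h x) + r ^ 2 / 2 * (fderiv ℝ h x z) ^ 2
      + r ^ 3 * (6 * (L * B + L ^ 3) * Real.exp ((L + 1) * ‖z‖)) := by
  have hL := hh.L_nonneg
  have h1 := hh.taylor hB x (r • z)
  have h2 := hh.lip (x + r • z) x
  have h3 := (fderiv ℝ h x).le_of_opNorm_le (hh.nL x) z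
  have h4 := exp_bound3 (h (x + r • z) - h x)
  set D := h (x + r • z) - h x
  simp only [map_smul, smul_eq_mul, norm_smul, Real.norm_eq_abs, abs_of_nonneg hr,
    add_sub_cancel_left] at h1 h2 h3
  set n := ‖z‖
  set l := fderiv ℝ h x z
  have hn : 0 ≤ n := norm_nonneg z
  have h5 : D ^ 2 ≤ r ^ 2 * l ^ 2 + 2 * L * B * r ^ 3 * n ^ 3 := by
    have e : D ^ 2 = r ^ 2 * l ^ 2 + (D - r * l) * (D + r * l) := by ring
    have a1 : |D + r * l| ≤ 2 * L * r * n := by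
      refine (abs_add_le _ _).trans ?_
      rw [abs_mul, abs_of_nonneg hr]
      nlinarith [mul_le_mul_of_nonneg_left h3 hr]
    have a2 : (D - r * l) * (D + r * l) ≤ B * (r * n) ^ 2 * (2 * L * r * n) := by
      refine (le_abs_self _).trans ?_
      rw [abs_mul]
      gcongr
    rw [e]; linarith [show B * (r * n) ^ 2 * (2 * L * r * n) = 2 * L * B * r ^ 3 * n ^ 3 by ring]
  have h6 : |D| ^ 3 * Real.exp |D| ≤ (L * (r * n)) ^ 3 * Real.exp (L * n) := by
    have : |D| ≤ L * n := h2.trans (by gcongr; nlinarith)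
    gcongr
  have h7 : n ^ 3 ≤ 6 * Real.exp n := cube_le n hn
  have h8 : Real.exp ((L + 1) * n) = Real.exp (L * n) * Real.exp n := by
    rw [← Real.exp_add]; ring_nf
  have h9 : 1 ≤ Real.exp (L * n) := Real.one_le_exp (by positivity)
  have h10 : n ^ 3 ≤ 6 * (Real.exp (L * n) * Real.exp n) := h7.trans (by
    nlinarith [Real.exp_pos n])
  have h11 : n ^ 3 * Real.exp (L * n) ≤ 6 * (Real.exp (L * n) * Real.exp n) := by
    nlinarith
  have h12 := mul_le_mul_of_nonneg_left h10 (show 0 ≤ L * B * r ^ 3 by positivity)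
  have h13 := mul_le_mul_of_nonneg_left h11 (show 0 ≤ L ^ 3 * r ^ 3 by positivity)
  rw [h8]
  nlinarith

lemma sq_int (l : StrongDual ℝ E) : Integrable (fun z => (l z) ^ 2) (stdGaussian E) ∧
    ∫ z, (l z) ^ 2 ∂(stdGaussian E) = ‖l‖ ^ 2 := by
  have hm : MemLp (fun z => l z) 2 (stdGaussian E) := IsGaussian.memLp_dual _ l 2 (by norm_num)
  refine ⟨hm.integrable_sq, ?_⟩
  rw [← variance_dual_stdGaussian l, variance_of_integral_eq_zero (by fun_prop)
    (integral_strongDual_stdGaussian l)]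

/-- sub-Gaussian bound property of a measure -/
def TP (L B : ℝ) (ν : Measure E) (c : ℝ) : Prop :=
  ∀ h : E → ℝ, Cls L B h → ∀ x,
    ∫ y, Real.exp (h (x + y)) ∂ν ≤ Real.exp (∫ y, h (x + y) ∂ν + c)

lemma Cls.int {L B : ℝ} {h : E → ℝ} (hh : Cls L B h) (ν : Measure E) [IsProbabilityMeasure ν]
    (T : E → E) (hT : Measurable T) : Integrable (fun y => h (T y)) ν := by
  obtain ⟨M, hM⟩ := hh.bd
  exact Integrable.of_bound (hh.diff.continuous.measurable.comp hT).aestronglyMeasurable M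
    (.of_forall fun y => hM _)

lemma Cls.int_exp {L B : ℝ} {h : E → ℝ} (hh : Cls L B h) (ν : Measure E) [IsProbabilityMeasure ν]
    (T : E → E) (hT : Measurable T) : Integrable (fun y => Real.exp (h (T y))) ν := by
  obtain ⟨M, hM⟩ := hh.bd
  refine Integrable.of_bound
    ((Real.measurable_exp.comp (hh.diff.continuous.measurable.comp hT)).aestronglyMeasurable)
    (Real.exp M) (.of_forall fun y => ?_)
  rw [Real.norm_of_nonneg (Real.exp_pos _).le, Real.exp_le_exp]
  exact (abs_le.1 (hM _)).2

lemma one_step {L B r : ℝ} (hB : 0 ≤ B) (hr : 0 ≤ r) (hr1 : r ≤ 1) :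
    TP L B ((stdGaussian E).map (fun z => r • z)) (r ^ 2 * (L ^ 2 / 2) + r ^ 3 *
      ∫ z : E, (6 * (L * B + L ^ 3) * Real.exp ((L + 1) * ‖z‖)) ∂(stdGaussian E)) := by
  intro h hh x
  have hc := hh.diff.continuous
  rw [integral_map (by fun_prop) (by fun_prop), integral_map (by fun_prop) (by fun_prop)]
  set γ := stdGaussian E
  have i1 : Integrable (fun z => h (x + r • z)) γ := hh.int γ (fun z => x + r • z) (by fun_prop)
  have i2 : Integrable (fun z => Real.exp (h (x + r • z))) γ :=
    hh.int_exp γ (fun z => x + r • z) (by fun_prop)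
  have i3 : Integrable (fun z : E => (6 * (L * B + L ^ 3) * Real.exp ((L + 1) * ‖z‖))) γ :=
    (integrable_exp_norm (L + 1)).const_mul _
  obtain ⟨i4, e4⟩ := sq_int (fderiv ℝ h x)
  have e1 : ∫ z, Real.exp (h (x + r • z)) ∂γ
      = Real.exp (h x) * ∫ z, Real.exp (h (x + r • z) - h x) ∂γ := by
    rw [← integral_const_mul]
    congr 1; ext z; rw [← Real.exp_add]; ring_nf
  have i5 : Integrable (fun z => Real.exp (h (x + r • z) - h x)) γ := by
    have := i2.const_mul (Real.exp (- h x))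
    refine this.congr (.of_forall fun z => ?_)
    simp only [← Real.exp_add]; ring_nf
  have j0 : Integrable (fun z => h (x + r • z) - h x) γ := i1.sub (integrable_const _)
  have j1 : Integrable (fun z => 1 + (h (x + r • z) - h x)) γ :=
    (integrable_const _).add (i1.sub (integrable_const _))
  have j2 : Integrable (fun z => r ^ 2 / 2 * (fderiv ℝ h x z) ^ 2) γ := i4.const_mul _
  have j3 : Integrable (fun z : E => r ^ 3 * (6 * (L * B + L ^ 3) * Real.exp ((L + 1) * ‖z‖))) γ :=
    i3.const_mul _
  have key := integral_mono i5 ((j1.add j2).add j3) (fun z => pointwise hB hr hr1 hh x z)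
  have j12 : Integrable (fun z => 1 + (h (x + r • z) - h x) +
    r ^ 2 / 2 * (fderiv ℝ h x z) ^ 2) γ := j1.add j2
  simp only [Pi.add_apply] at key
  rw [integral_add j12 j3, integral_add j1 j2, integral_add (integrable_const _) j0,
    integral_sub i1 (integrable_const _), integral_const_mul,
    integral_const_mul (r ^ 3), e4] at key
  simp only [integral_const, probReal_univ, one_smul] at key
  set I := ∫ z, h (x + r • z) ∂γ
  set G := ∫ z : E, (6 * (L * B + L ^ 3) * Real.exp ((L + 1) * ‖z‖)) ∂γ
  have hn : ‖fderiv ℝ h x‖ ^ 2 ≤ L ^ 2 := by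
    have := hh.nL x
    gcongr
  have k2 : ∫ z, Real.exp (h (x + r • z) - h x) ∂γ ≤
      Real.exp (I - h x + (r ^ 2 * (L ^ 2 / 2) + r ^ 3 * G)) := by
    refine key.trans ?_
    refine le_trans ?_ (Real.add_one_le_exp _)
    nlinarith [mul_le_mul_of_nonneg_left hn (sq_nonneg r)]
  rw [e1]
  refine (mul_le_mul_of_nonneg_left k2 (Real.exp_pos _).le).trans ?_
  rw [← Real.exp_add]
  apply le_of_eq; ring_nf

lemma TP.conv {L B c₁ c₂ : ℝ} {ν₁ ν₂ : Measure E} [IsProbabilityMeasure ν₁]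
    [IsProbabilityMeasure ν₂] (h₁ : TP L B ν₁ c₁) (h₂ : TP L B ν₂ c₂) :
    TP L B (ν₁.conv ν₂) (c₁ + c₂) := by
  intro h hh x
  rw [integral_conv (hh.int_exp _ (fun y => x + y) (by fun_prop)),
    integral_conv (hh.int _ (fun y => x + y) (by fun_prop))]
  have hav := hh.avg ν₂
  have hc := hh.diff.continuous
  have A := h₁ _ hav x
  calc ∫ y₁, ∫ y₂, Real.exp (h (x + (y₁ + y₂))) ∂ν₂ ∂ν₁
      ≤ ∫ y₁, Real.exp (∫ y₂, h (x + y₁ + y₂) ∂ν₂) * Real.exp c₂ ∂ν₁ := by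
        refine integral_mono_of_nonneg (.of_forall fun y => integral_nonneg fun _ =>
          (Real.exp_pos _).le) ((hav.int_exp ν₁ (fun y => x + y) (by fun_prop)).mul_const _)
          (.of_forall fun y => ?_)
        simp only
        rw [← Real.exp_add]
        simpa [add_assoc] using h₂ h hh (x + y)
    _ ≤ Real.exp (∫ y₁, ∫ y₂, h (x + y₁ + y₂) ∂ν₂ ∂ν₁ + c₁) * Real.exp c₂ := by
        rw [integral_mul_const]
        gcongr
    _ = _ := by
        rw [← Real.exp_add]; simp only [add_assoc]

lemma TP.iter {L B c : ℝ} {ν : Measure E} [IsProbabilityMeasure ν] (h : TP L B ν c) (n : ℕ) :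
    ∃ ρ : Measure E, IsProbabilityMeasure ρ ∧ TP L B ρ (n * c) ∧
      ∀ t, charFun ρ t = (charFun ν t) ^ n := by
  induction n with
  | zero =>
    refine ⟨Measure.dirac 0, inferInstance, ?_, ?_⟩
    · intro h hh x
      simp
    · intro t; simp
  | succ n ih =>
    obtain ⟨ρ, hρ, h1, h2⟩ := ih
    refine ⟨ρ.conv ν, inferInstance, ?_, ?_⟩
    · have := h1.conv h
      convert this using 1
      push_cast; ring
    · intro t
      rw [charFun_conv, h2, pow_succ]

lemma std_n {L B : ℝ} (hB : 0 ≤ B) (n : ℕ) (hn : 0 < n) :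
    TP L B (stdGaussian E) (L ^ 2 / 2 + (√n)⁻¹ *
      ∫ z : E, (6 * (L * B + L ^ 3) * Real.exp ((L + 1) * ‖z‖)) ∂(stdGaussian E)) := by
  have hn' : (0 : ℝ) < n := by exact_mod_cast hn
  have hs : 0 < √(n : ℝ) := Real.sqrt_pos.2 hn'
  have hs1 : 1 ≤ √(n : ℝ) := Real.one_le_sqrt.2 (by exact_mod_cast hn)
  have hsq : (√(n : ℝ)) ^ 2 = n := Real.sq_sqrt hn'.le
  have h1 := one_step (E := E) (L := L) hB (r := (√(n : ℝ))⁻¹) (by positivity)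
    (inv_le_one_of_one_le₀ hs1)
  have : IsProbabilityMeasure ((stdGaussian E).map (fun z => (√(n : ℝ))⁻¹ • z)) :=
    Measure.isProbabilityMeasure_map (by fun_prop)
  obtain ⟨ρ, hρ, h2, h3⟩ := h1.iter n
  have e : ρ = stdGaussian E := by
    apply Measure.ext_of_charFun
    ext t
    rw [h3, charFun_map_smul, charFun_stdGaussian, charFun_stdGaussian, ← Complex.exp_nat_mul,
      norm_smul, Real.norm_of_nonneg (by positivity)]
    congr 1
    push_cast
    rw [mul_pow, inv_pow, ← Complex.ofReal_pow, hsq]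
    have : (n : ℂ) ≠ 0 := by exact_mod_cast hn.ne'
    push_cast
    field_simp
  rw [e] at h2
  convert h2 using 1
  set G := ∫ z : E, (6 * (L * B + L ^ 3) * Real.exp ((L + 1) * ‖z‖)) ∂(stdGaussian E)
  have : (n : ℝ) * ((√(n : ℝ))⁻¹) ^ 2 = 1 := by rw [inv_pow, hsq]; field_simp
  linear_combination (- L ^ 2 / 2 - (√(n : ℝ))⁻¹ * G) * this

lemma std_TP {L B : ℝ} (hB : 0 ≤ B) : TP L B (stdGaussian E) (L ^ 2 / 2) := by
  intro h hh x
  set G := ∫ z : E, (6 * (L * B + L ^ 3) * Real.exp ((L + 1) * ‖z‖)) ∂(stdGaussian E) with hG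
  have lim : Filter.Tendsto (fun n : ℕ => Real.exp (∫ y, h (x + y) ∂(stdGaussian E) +
      (L ^ 2 / 2 + (√(n : ℝ))⁻¹ * G))) Filter.atTop
      (nhds (Real.exp (∫ y, h (x + y) ∂(stdGaussian E) + (L ^ 2 / 2 + 0 * G)))) := by
    refine (Real.continuous_exp.tendsto _).comp (tendsto_const_nhds.add (tendsto_const_nhds.add
      (Filter.Tendsto.mul_const G ?_)))
    exact tendsto_inv_atTop_zero.comp (Real.tendsto_sqrt_atTop.comp tendsto_natCast_atTop_atTop)
  rw [zero_mul, add_zero] at lim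
  refine ge_of_tendsto lim ?_
  filter_upwards [Filter.eventually_gt_atTop 0] with n hn
  exact std_n hB n hn h hh x

/-- Mollification. -/
lemma mollify (f : E → ℝ) (C : NNReal) (hf : LipschitzWith C f) (hb : ∃ M : ℝ, ∀ x, |f x| ≤ M)
    (δ : ℝ) (hδ : 0 < δ) (A : E →L[ℝ] E) (L : ℝ)
    (hA : ∀ y, DifferentiableAt ℝ f y → ∀ v, |fderiv ℝ f y (A v)| ≤ L * ‖v‖) :
    ∃ (F : E → ℝ) (B : ℝ), 0 ≤ B ∧ (∀ x, |F x - f x| ≤ C * δ) ∧ Differentiable ℝ F ∧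
      (∀ x y, ‖fderiv ℝ F x - fderiv ℝ F y‖ ≤ B * ‖x - y‖) ∧
      (∀ x v, |fderiv ℝ F x (A v)| ≤ L * ‖v‖) := by
  let φ : ContDiffBump (0 : E) := ⟨δ / 2, δ, by positivity, by linarith⟩
  let μ : Measure E := volume
  let w : E → ℝ := φ.normed μ
  have hw0 : ∀ x, 0 ≤ w x := φ.nonneg_normed
  have hwc : Continuous w := φ.continuous_normed
  have hwi : Integrable w μ := hwc.integrable_of_hasCompactSupport φ.hasCompactSupport_normed
  have hw1 : ∫ x, w x ∂μ = 1 := φ.integral_normed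
  have hwd : ContDiff ℝ 1 w := φ.contDiff_normed (n := 1)
  let F : E → ℝ := convolution w f (ContinuousLinearMap.lsmul ℝ ℝ) μ
  have hfc := hf.continuous
  have hF : ∀ x, HasFDerivAt F
      (∫ t, ((ContinuousLinearMap.lsmul ℝ ℝ).precompL E) (fderiv ℝ w t) (f (x - t)) ∂μ) x := fun x =>
    HasCompactSupport.hasFDerivAt_convolution_left (ContinuousLinearMap.lsmul ℝ ℝ) (μ := μ)
      φ.hasCompactSupport_normed hwd (hfc.locallyIntegrable) x
  have hdi : Integrable (fderiv ℝ w) μ :=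
    (hwd.continuous_fderiv (by norm_num)).integrable_of_hasCompactSupport
      (φ.hasCompactSupport_normed.fderiv ℝ)
  obtain ⟨M, hM⟩ := hb
  have hli : ∀ x, Integrable (fun t => ((ContinuousLinearMap.lsmul ℝ ℝ).precompL E)
      (fderiv ℝ w t) (f (x - t))) μ := by
    intro x
    refine (hdi.norm.mul_const M).mono' ?_ (.of_forall fun t => ?_)
    · have h1 := hwd.continuous_fderiv (by norm_num)
      apply Continuous.aestronglyMeasurable
      fun_prop
    · refine ContinuousLinearMap.opNorm_le_bound _ ?_ ?_
      · exact mul_nonneg (norm_nonneg _) ((abs_nonneg _).trans (hM 0))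
      intro v
      simp only [ContinuousLinearMap.precompL_apply, ContinuousLinearMap.lsmul_apply, smul_eq_mul,
        norm_mul]
      have := (fderiv ℝ w t).le_opNorm v
      have h2 := hM (x - t)
      calc _ ≤ (‖fderiv ℝ w t‖ * ‖v‖) * M := by
            gcongr
            exact h2
        _ = _ := by ring
  refine ⟨F, C * ∫ t, ‖fderiv ℝ w t‖ ∂μ, by positivity, ?_, fun x => (hF x).differentiableAt,
    ?_, ?_⟩
  · intro x
    have := ContDiffBump.dist_normed_convolution_le (φ := φ) (μ := μ) (g := f) (x₀ := x)
      (ε := C * δ) hfc.aestronglyMeasurable (fun y hy => (hf.dist_le_mul y x).trans (by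
        have : dist y x ≤ δ := (Metric.mem_ball.1 hy).le
        gcongr))
    simpa [Real.dist_eq] using this
  · intro x y
    rw [(hF x).fderiv, (hF y).fderiv, ← integral_sub (hli x) (hli y)]
    refine (norm_integral_le_of_norm_le (g := fun t => ‖fderiv ℝ w t‖ * (C * ‖x - y‖))
      (hdi.norm.mul_const _) (.of_forall fun t => ?_)).trans ?_
    · rw [← map_sub]
      refine ContinuousLinearMap.opNorm_le_bound _ (by positivity) ?_
      intro v
      simp only [ContinuousLinearMap.precompL_apply, ContinuousLinearMap.lsmul_apply, smul_eq_mul,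
        norm_mul]
      have := (fderiv ℝ w t).le_opNorm v
      have h2 := hf.dist_le_mul (x - t) (y - t)
      rw [dist_eq_norm, dist_eq_norm, sub_sub_sub_cancel_right] at h2
      calc _ ≤ (‖fderiv ℝ w t‖ * ‖v‖) * (C * ‖x - y‖) := by
            gcongr
        _ = _ := by ring
    · rw [integral_mul_const]
      apply le_of_eq; ring
  · intro x v
    let ρ : Measure E := μ.withDensity (fun t => ENNReal.ofReal (w t))
    have hρ : IsProbabilityMeasure ρ := by
      constructor
      rw [withDensity_apply _ MeasurableSet.univ, Measure.restrict_univ,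
        ← ofReal_integral_eq_lintegral_ofReal hwi (.of_forall hw0), hw1, ENNReal.ofReal_one]
    have hac : ρ ≪ μ := withDensity_absolutelyContinuous _ _
    have hd0 : ∀ᵐ y ∂μ, DifferentiableAt ℝ f y := hf.ae_differentiableAt
    have hd : ∀ᵐ y ∂ρ, DifferentiableAt ℝ f (x + -y) := by
      apply hac.ae_le
      have := (Measure.measurePreserving_sub_left μ x).quasiMeasurePreserving.ae hd0
      simp only [sub_eq_add_neg] at this
      exact this
    obtain ⟨hFint, hder⟩ := avg ρ (fun y => -y) measurable_neg f C
      (fun x y => by simpa [dist_eq_norm] using hf.dist_le_mul x y) hfc ⟨M, hM⟩ x hd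
    have hFe : F = fun x => ∫ y, f (x + -y) ∂ρ := by
      ext x
      change ∫ t, w t • f (x - t) ∂μ = _
      rw [integral_withDensity_eq_integral_toReal_smul (by fun_prop) (by simp)]
      congr 1; ext t
      rw [ENNReal.toReal_ofReal (hw0 t), sub_eq_add_neg]
    rw [hFe, hder.fderiv, ContinuousLinearMap.integral_apply hFint]
    have := norm_integral_le_of_norm_le_const (μ := ρ) (C := L * ‖v‖)
      (f := fun y => fderiv ℝ f (x + -y) (A v)) (by
        filter_upwards [hd] with y hy
        exact hA _ hy v)
    simpa using this

/-- Concentration for the standard Gaussian under an affine map. -/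
lemma main_bound (f : E → ℝ) (C : NNReal) (hf : LipschitzWith C f) (hb : ∃ M : ℝ, ∀ x, |f x| ≤ M)
    (A : E →L[ℝ] E) (L : ℝ) (hL : 0 ≤ L)
    (hA : ∀ y, DifferentiableAt ℝ f y → ∀ v, |fderiv ℝ f y (A v)| ≤ L * ‖v‖) (m : E) :
    ∫ z, Real.exp (f (m + A z)) ∂(stdGaussian E) ≤
      Real.exp (∫ z, f (m + A z) ∂(stdGaussian E) + L ^ 2 / 2) := by
  set γ := stdGaussian E
  have hfc := hf.continuous
  have step : ∀ δ > 0, ∫ z, Real.exp (f (m + A z)) ∂γ ≤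
      Real.exp (∫ z, f (m + A z) ∂γ + L ^ 2 / 2 + 2 * (C * δ)) := by
    intro δ hδ
    obtain ⟨F, B, hB, h1, h2, h3, h4⟩ := mollify f C hf hb δ hδ A L hA
    obtain ⟨M, hM⟩ := hb
    let g : E → ℝ := fun z => F (m + A z)
    have hg' : ∀ z, HasFDerivAt g ((fderiv ℝ F (m + A z)).comp A) z := fun z =>
      (h2 _).hasFDerivAt.comp z (A.hasFDerivAt.const_add m)
    have hg : Cls L (B * ‖A‖ * ‖A‖) g := by
      refine ⟨fun z => (hg' z).differentiableAt, ⟨M + C * δ, fun z => ?_⟩, fun z => ?_,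
        fun y z => ?_⟩
      · have e : g z = f (m + A z) + (F (m + A z) - f (m + A z)) := by simp [g]
        rw [e]
        exact (abs_add_le _ _).trans (add_le_add (hM _) (h1 _))
      · rw [(hg' z).fderiv]
        exact ContinuousLinearMap.opNorm_le_bound _ hL (fun v => h4 _ v)
      · rw [(hg' z).fderiv, (hg' y).fderiv, ← ContinuousLinearMap.sub_comp]
        refine (ContinuousLinearMap.opNorm_comp_le _ _).trans ?_
        have e1 := h3 (m + A y) (m + A z)
        have e2 := A.le_opNorm (y - z)
        rw [add_sub_add_left_eq_sub, ← map_sub] at e1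
        calc _ ≤ (B * (‖A‖ * ‖y - z‖)) * ‖A‖ := by
              gcongr
              exact e1.trans (by gcongr)
          _ = _ := by ring
    have key := std_TP (E := E) (L := L) (B := B * ‖A‖ * ‖A‖) (by positivity) g hg 0
    simp only [zero_add] at key
    have i1 : Integrable (fun z => f (m + A z)) γ := by
      refine Integrable.of_bound (Continuous.aestronglyMeasurable (by fun_prop)) M
        (.of_forall fun y => hM _)
    have i2 : Integrable g γ := hg.int γ (fun z => z) measurable_id
    have i3 : Integrable (fun z => Real.exp (g z)) γ := hg.int_exp γ (fun z => z) measurable_id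
    have k1 : ∫ z, g z ∂γ ≤ ∫ z, f (m + A z) ∂γ + C * δ := by
      have := integral_mono i2 (i1.add (integrable_const (C * δ : ℝ))) (fun z => by
        have := (abs_le.1 (h1 (m + A z))).2
        simp only [Pi.add_apply, g]; linarith)
      simp only [Pi.add_apply] at this
      rw [integral_add i1 (integrable_const _)] at this
      simpa using this
    have k2 : ∫ z, Real.exp (f (m + A z)) ∂γ ≤ ∫ z, Real.exp (g z) * Real.exp (C * δ) ∂γ := by
      refine integral_mono_of_nonneg (.of_forall fun _ => (Real.exp_pos _).le)
        (i3.mul_const _) (.of_forall fun z => ?_)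
      simp only
      rw [← Real.exp_add, Real.exp_le_exp]
      have := (abs_le.1 (h1 (m + A z))).1
      simp only [g]; linarith
    rw [integral_mul_const] at k2
    refine k2.trans ((mul_le_mul_of_nonneg_right key (Real.exp_pos _).le).trans ?_)
    rw [← Real.exp_add, Real.exp_le_exp]
    linarith
  have lim : Filter.Tendsto (fun n : ℕ => Real.exp (∫ z, f (m + A z) ∂γ + L ^ 2 / 2 +
      2 * (C * (1 / ((n : ℝ) + 1))))) Filter.atTop
      (nhds (Real.exp (∫ z, f (m + A z) ∂γ + L ^ 2 / 2 + 2 * (C * 0)))) := by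
    refine (Real.continuous_exp.tendsto _).comp (tendsto_const_nhds.add
      (Filter.Tendsto.const_mul _ (Filter.Tendsto.const_mul _ ?_)))
    exact tendsto_one_div_add_atTop_nhds_zero_nat
  simp only [mul_zero, add_zero] at lim
  exact ge_of_tendsto' lim (fun n => step _ (by positivity))

end General

lemma gauss_eq {d : ℕ} (P : Measure (EuclideanSpace ℝ (Fin d)))
    (m : EuclideanSpace ℝ (Fin d)) (S : Matrix (Fin d) (Fin d) ℝ)
    (hP : IsGaussianMeasure P m S) (hpsd : S.PosSemidef) : P = multivariateGaussian m S := by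
  have := hP.1
  apply Measure.ext_of_charFun
  ext t
  rw [charFun_multivariateGaussian hpsd, charFun_apply]
  have := hP.2 t
  convert this using 1
  · congr 1; ext x
    rw [mul_comm]
    congr 4
  · congr 1
    congr 1
    · rw [mul_comm]
      congr 2
    · congr 2
      simp only [dotProduct, Matrix.mulVec, Finset.mul_sum]
      refine Finset.sum_congr rfl fun i _ => Finset.sum_congr rfl fun j _ => ?_
      ring

lemma sqrt_norm {d : ℕ} (S : Matrix (Fin d) (Fin d) ℝ) (hpsd : S.PosSemidef)
    (g v : EuclideanSpace ℝ (Fin d)) (K : ℝ) (hK : 0 ≤ K)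
    (h : ∑ i, ∑ j, S i j * g i * g j ≤ K) :
    |inner ℝ g (Matrix.toEuclideanCLM (𝕜 := ℝ) (CFC.sqrt S) v)| ≤ √K * ‖v‖ := by
  set A := Matrix.toEuclideanCLM (𝕜 := ℝ) (CFC.sqrt S) with hAdef
  have hsa : IsSelfAdjoint A := (CFC.sqrt_nonneg S).isSelfAdjoint.map _
  have hsym : ∀ x y, inner ℝ x (A y) = inner ℝ (A x) y := by
    intro x y
    rw [← ContinuousLinearMap.adjoint_inner_left, hsa.adjoint_eq]
  have h1 : ‖A g‖ ^ 2 ≤ K := by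
    rw [← real_inner_self_eq_norm_sq, ← hsym, ← ContinuousLinearMap.comp_apply,
      ← ContinuousLinearMap.mul_def, hAdef, ← map_mul,
      CFC.sqrt_mul_sqrt_self _ hpsd.nonneg, Matrix.inner_toEuclideanCLM]
    convert h using 1
    simp only [dotProduct, Matrix.mulVec, Finset.mul_sum]
    refine Finset.sum_congr rfl fun i _ => Finset.sum_congr rfl fun j _ => ?_
    ring
  rw [hsym]
  refine (abs_real_inner_le_norm _ _).trans ?_
  gcongr
  exact Real.le_sqrt_of_sq_le h1

end GaussAux

/-- If `X ~ N(m, S)` and `f` is bounded and Lipschitz with `E f(X) = 0`, then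
`E[exp(t f(X))] ≤ exp(t² ‖Σ^{1/2}∇f‖²_∞ / 2)` for all real `t`. -/
theorem stmt1 {d : ℕ} (P : Measure (EuclideanSpace ℝ (Fin d)))
    (m : EuclideanSpace ℝ (Fin d)) (S : Matrix (Fin d) (Fin d) ℝ)
    (hP : IsGaussianMeasure P m S) (hS : S.IsSymm) (hpsd : S.PosSemidef)
    (f : EuclideanSpace ℝ (Fin d) → ℝ) (C : NNReal) (hf : LipschitzWith C f)
    (hbdd : ∃ M : ℝ, ∀ y, |f y| ≤ M)
    (hmean : ∫ y, f y ∂P = 0) (K : ℝ) (hK : 0 ≤ K)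
    (hgrad : ∀ y, DifferentiableAt ℝ f y →
      ∑ i, ∑ j, S i j * gradient f y i * gradient f y j ≤ K)
    (t : ℝ) :
    ∫ y, Real.exp (t * f y) ∂P ≤ Real.exp (t ^ 2 * K / 2) := by
  have hPe := GaussAux.gauss_eq P m S hP hpsd
  obtain ⟨M, hM⟩ := hbdd
  set A := Matrix.toEuclideanCLM (𝕜 := ℝ) (CFC.sqrt S) with hAdef
  have hfc := hf.continuous
  have hPm : P = (stdGaussian (EuclideanSpace ℝ (Fin d))).map (fun z => m + A z) := hPe
  have hlip : LipschitzWith (‖t‖₊ * C) (fun y => t * f y) := by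
    refine LipschitzWith.of_dist_le_mul fun x y => ?_
    rw [Real.dist_eq, ← mul_sub, abs_mul, NNReal.coe_mul, coe_nnnorm, Real.norm_eq_abs, mul_assoc]
    gcongr
    exact hf.dist_le_mul x y
  have key := GaussAux.main_bound (fun y => t * f y) (‖t‖₊ * C) hlip
    ⟨|t| * M, fun x => by rw [abs_mul]; gcongr; exact hM x⟩ A (|t| * √K) (by positivity) (by
      intro y hy v
      by_cases ht : t = 0
      · subst ht; simp
      have hy' : DifferentiableAt ℝ f y := by
        have := hy.const_mul t⁻¹
        simpa [ht] using this
      rw [fderiv_const_mul hy']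
      have h1 := GaussAux.sqrt_norm S hpsd (gradient f y) v K hK (hgrad y hy')
      have h2 : inner ℝ (gradient f y) (A v) = fderiv ℝ f y (A v) := by
        rw [gradient, InnerProductSpace.toDual_symm_apply]
      rw [← hAdef, h2] at h1
      simp only [ContinuousLinearMap.smul_apply, smul_eq_mul, abs_mul, mul_assoc]
      gcongr) m
  rw [hPm, integral_map (by fun_prop) (by fun_prop)]
  rw [hPm, integral_map (by fun_prop) (by fun_prop)] at hmean
  refine key.trans (le_of_eq ?_)
  rw [integral_const_mul, hmean, mul_pow, Real.sq_sqrt hK, sq_abs]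
  ring_nf
end

section
/- Let X ~ N(μ, Σ) on ℝ^d and let f, g : ℝ^d → ℝ be C¹ with bounded gradients. Then Cov(f(X), g(X)) = ∫₀¹ E⟨Σ∇f(X_α), ∇g(Y_α)⟩ dα, where for each α ∈ [0,1], (X_α, Y_α) is a Gaussian vector in ℝ^{2d} with mean (μ, μ) and covariance matrix with diagonal blocks Σ and off-diagonal blocks αΣ. -/
open MeasureTheory Finset

open ProbabilityTheory in
/-- A continuous function of at most quadratic growth is integrable for a Gaussian measure. -/
lemma integrable_of_quadratic {E : Type*} [NormedAddCommGroup E] [NormedSpace ℝ E]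
    [MeasurableSpace E] [BorelSpace E] [SecondCountableTopology E] [CompleteSpace E]
    (μ : Measure E) [IsGaussian μ] (F : E → ℝ) (hF : Continuous F) (C : ℝ)
    (hb : ∀ x, |F x| ≤ C * (1 + ‖x‖) ^ 2) : Integrable F μ := by
  have h1 : MemLp (fun x : E => 1 + ‖x‖) 2 μ := by
    have ha : MemLp (fun _ : E => (1 : ℝ)) 2 μ := memLp_const 1
    have hb : MemLp (fun x : E => ‖x‖) 2 μ := (IsGaussian.memLp_two_id (μ := μ)).norm
    exact ha.add hb
  have h2 : Integrable (fun x : E => C * (1 + ‖x‖) ^ 2) μ := h1.integrable_sq.const_mul C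
  exact h2.mono' hF.aestronglyMeasurable (Filter.Eventually.of_forall hb)

/-- A C¹ function with bounded derivative grows at most linearly. -/
lemma abs_le_of_fderiv_bound {E : Type*} [NormedAddCommGroup E] [NormedSpace ℝ E]
    (f : E → ℝ) (hf : ContDiff ℝ 1 f) (M : ℝ) (hM : ∀ y, ‖fderiv ℝ f y‖ ≤ M) (x y : E) :
    |f (x + y)| ≤ |f x| + M * ‖y‖ := by
  have h := Convex.norm_image_sub_le_of_norm_fderiv_le (𝕜 := ℝ) (f := f) (C := M)
    (s := Set.univ) (x := x) (y := x + y)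
    (fun z _ => (hf.differentiable (by norm_num)).differentiableAt) (fun z _ => hM z)
    convex_univ trivial trivial
  rw [add_sub_cancel_left, Real.norm_eq_abs] at h
  have := abs_sub_abs_le_abs_sub (f (x + y)) (f x)
  linarith

open ProbabilityTheory NNReal in
/-- One-dimensional Stein identity. -/
lemma stein_real (v : ℝ≥0) (F F' : ℝ → ℝ) (hF : ∀ t, HasDerivAt F (F' t) t)
    (hF' : Continuous F') (M : ℝ) (hM : ∀ t, |F' t| ≤ M) :
    ∫ t, F t * t ∂(gaussianReal 0 v) = v * ∫ t, F' t ∂(gaussianReal 0 v) := by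
  by_cases hv : v = 0
  · subst hv; simp
  have hFc : Continuous F := continuous_iff_continuousAt.2 fun t => (hF t).continuousAt
  have hM0 : 0 ≤ M := (abs_nonneg _).trans (hM 0)
  have hlin : ∀ t, |F t| ≤ |F 0| + M * |t| := by
    intro t
    have h := Convex.norm_image_sub_le_of_norm_hasDerivWithin_le (𝕜 := ℝ) (f := F) (C := M)
      (s := Set.univ) (x := 0) (y := t) (f' := F')
      (fun z _ => (hF z).hasDerivWithinAt) (fun z _ => hM z)
      convex_univ trivial trivial
    rw [sub_zero, Real.norm_eq_abs, Real.norm_eq_abs] at h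
    have := abs_sub_abs_le_abs_sub (F t) (F 0)
    linarith
  have i1 : Integrable (fun t => F t * t) (gaussianReal 0 v) := by
    refine integrable_of_quadratic _ _ (by fun_prop) (|F 0| + M) fun t => ?_
    rw [abs_mul, Real.norm_eq_abs]
    have h0 := abs_nonneg t
    have h1 := abs_nonneg (F 0)
    calc |F t| * |t| ≤ (|F 0| + M * |t|) * |t| := by gcongr; exact hlin t
      _ ≤ (|F 0| + M) * (1 + |t|) ^ 2 := by nlinarith [mul_nonneg h0 h1, mul_nonneg hM0 h0, mul_nonneg h1 (sq_nonneg |t|)]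
  have i2 : Integrable F' (gaussianReal 0 v) := by
    refine integrable_of_quadratic _ _ hF' M fun t => ?_
    have h0 := norm_nonneg t
    have := hM t
    nlinarith [mul_nonneg hM0 h0, mul_nonneg hM0 (sq_nonneg ‖t‖)]
  have i3 : Integrable F (gaussianReal 0 v) := by
    refine integrable_of_quadratic _ _ hFc (|F 0| + M) fun t => ?_
    have h0 := abs_nonneg t
    have h1 := abs_nonneg (F 0)
    have := hlin t
    rw [Real.norm_eq_abs]
    nlinarith [mul_nonneg h0 h1, mul_nonneg hM0 h0, mul_nonneg h1 (sq_nonneg |t|), mul_nonneg hM0 (sq_nonneg |t|)]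
  have key : ∀ G : ℝ → ℝ, Integrable G (gaussianReal 0 v) →
      Integrable (fun t => gaussianPDFReal 0 v t * G t) := by
    intro G hG
    rw [gaussianReal_of_var_ne_zero _ hv, integrable_withDensity_iff_integrable_smul'
      (measurable_gaussianPDF _ _) (Filter.Eventually.of_forall fun _ => gaussianPDF_lt_top)] at hG
    simpa using hG
  have hpdf : ∀ t, HasDerivAt (gaussianPDFReal 0 v) (- (t / v) * gaussianPDFReal 0 v t) t := by
    intro t
    rw [gaussianPDFReal_def]
    have hv' : (v : ℝ) ≠ 0 := by exact_mod_cast hv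
    have h1 : HasDerivAt (fun x : ℝ => -(x - 0) ^ 2 / (2 * (v : ℝ))) (-(t / v)) t := by
      have h2 : HasDerivAt (fun x : ℝ => x ^ 2) (2 * t) t := by simpa using hasDerivAt_pow 2 t
      have h3 := h2.neg.div_const (2 * (v : ℝ))
      have h4 : -(2 * t) / (2 * (v : ℝ)) = -(t / v) := by field_simp
      rw [h4] at h3
      simpa using h3
    have h5 := h1.exp.const_mul ((√(2 * Real.pi * v))⁻¹)
    refine h5.congr_deriv ?_
    ring
  have ibp := integral_mul_deriv_eq_deriv_mul_of_integrable (u := F) (u' := F')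
    (v := gaussianPDFReal 0 v) (v' := fun t => - (t / v) * gaussianPDFReal 0 v t)
    (fun t _ => hF t) (fun t _ => hpdf t)
    (by
      refine ((key _ i1).const_mul (-(1 / (v : ℝ)))).congr (Filter.Eventually.of_forall fun t => ?_)
      simp only [Pi.mul_apply]; ring)
    (by
      refine (key _ i2).congr (Filter.Eventually.of_forall fun t => ?_)
      simp only [Pi.mul_apply]; ring)
    (by
      refine (key _ i3).congr (Filter.Eventually.of_forall fun t => ?_)
      simp only [Pi.mul_apply]; ring)
  rw [integral_gaussianReal_eq_integral_smul hv, integral_gaussianReal_eq_integral_smul hv]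
  have hv' : (v : ℝ) ≠ 0 := by exact_mod_cast hv
  have e1 : ∫ t, gaussianPDFReal 0 v t • (F t * t)
      = -(v : ℝ) * ∫ t, F t * (- (t / v) * gaussianPDFReal 0 v t) := by
    rw [← integral_const_mul]
    congr 1; ext t
    simp only [smul_eq_mul]
    field_simp
  rw [e1, ibp]
  simp only [smul_eq_mul, mul_comm (F' _)]
  ring

open ProbabilityTheory RealInnerProductSpace in
/-- Stein identity for a centered Gaussian measure. -/
lemma stein_gaussian {E : Type*} [NormedAddCommGroup E] [InnerProductSpace ℝ E]
    [MeasurableSpace E] [BorelSpace E] [SecondCountableTopology E] [CompleteSpace E]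
    (ν : Measure E) [IsGaussian ν] (h0 : ∫ x, x ∂ν = 0) (A : E →L[ℝ] E)
    (hA : ∀ x y : E, cov[fun u => inner ℝ x u, fun u => inner ℝ y u; ν] = inner ℝ x (A y))
    (h : E → ℝ) (hh : ContDiff ℝ 1 h) (M : ℝ) (hM : ∀ y, ‖fderiv ℝ h y‖ ≤ M) (a : E) :
    ∫ y, h y * inner ℝ a y ∂ν = ∫ y, fderiv ℝ h y (A a) ∂ν := by
  have hmean : ∀ x : E, ∫ u, inner ℝ x u ∂ν = 0 := by
    intro x
    have := IsGaussian.integral_dual (μ := ν) (innerSL ℝ x)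
    simpa [h0] using this
  have hL2 : ∀ x : E, MemLp (fun u => inner ℝ x u) 2 ν := fun x =>
    IsGaussian.memLp_dual ν (innerSL ℝ x) 2 (by simp)
  have hcm : ∀ x y : E, ∫ u, inner ℝ x u * inner ℝ y u ∂ν = inner ℝ x (A y) := by
    intro x y
    rw [← hA, covariance_eq_sub (hL2 x) (hL2 y)]
    simp [hmean]
  by_cases hs : inner ℝ a (A a) = 0
  · have hz : ∀ᵐ u ∂ν, inner ℝ a u = 0 := by
      have h1 : ∫ u, (inner ℝ a u) ^ 2 ∂ν = 0 := by
        rw [← hs, ← hcm]; simp only [sq]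
      rw [integral_eq_zero_iff_of_nonneg (fun u => sq_nonneg _) (hL2 a).integrable_sq] at h1
      filter_upwards [h1] with u hu
      simpa using hu
    have hAa : A a = 0 := by
      rw [← inner_self_eq_zero (𝕜 := ℝ), ← hcm]
      rw [integral_eq_zero_of_ae]
      filter_upwards [hz] with u hu
      simp [hu]
    rw [hAa]
    simp only [map_zero, integral_zero]
    apply integral_eq_zero_of_ae
    filter_upwards [hz] with u hu
    simp [hu]
  · set s : ℝ := inner ℝ a (A a) with hsdef
    have hs0 : 0 ≤ s := by
      rw [hsdef, ← hcm]; exact integral_nonneg fun u => mul_self_nonneg _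
    set c : E := s⁻¹ • A a with hc
    let T : E →L[ℝ] ℝ := innerSL ℝ a
    have hT : ∀ u, T u = inner ℝ a u := fun u => rfl
    let R : E →L[ℝ] E := ContinuousLinearMap.id ℝ E - T.smulRight c
    have hR : ∀ u, R u = u - T u • c := fun u => rfl
    have hind : IndepFun R T ν := by
      have hG : HasGaussianLaw (fun u => (R u, T u)) ν :=
        ⟨isGaussian_map (μ := ν) (R.prod T)⟩
      apply hG.indepFun_of_covariance_inner
      intro x y
      have e1 : (fun u => inner ℝ x (R u)) = fun u => inner ℝ (x - inner ℝ x c • a) u := by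
        ext u
        rw [hR, hT, inner_sub_right, inner_sub_left, inner_smul_right, inner_smul_left]
        simp [mul_comm]
      have e2 : (fun u => inner ℝ y (T u)) = fun u => inner ℝ (y • a) u := by
        ext u
        rw [hT, inner_smul_left]
        simp [mul_comm]
      rw [e1, e2, hA, map_smul, inner_smul_right, inner_sub_left, inner_smul_left, ← hsdef,
        hc, inner_smul_right]
      simp
      field_simp
      simp
    have hlawT : ν.map T = gaussianReal 0 s.toNNReal := by
      rw [IsGaussian.map_eq_gaussianReal]
      congr 2
      · exact hmean a
      · rw [← covariance_self T.continuous.aemeasurable]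
        exact hA a a
    have hprod := (indepFun_iff_map_prod_eq_prod_map_map R.continuous.aemeasurable
      T.continuous.aemeasurable).1 hind
    have tr : ∀ G : E × ℝ → ℝ, Continuous G → Integrable (fun u => G (R u, T u)) ν →
        ∫ u, G (R u, T u) ∂ν = ∫ r, ∫ t, G (r, t) ∂(gaussianReal 0 s.toNNReal) ∂(ν.map R) := by
      intro G hG hi
      have hm : AEMeasurable (fun u => (R u, T u)) ν :=
        (R.continuous.prodMk T.continuous).aemeasurable
      rw [← integral_map (f := G) hm hG.aestronglyMeasurable, hprod, hlawT]
      rw [integral_prod]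
      rw [← hlawT, ← hprod]
      rw [integrable_map_measure hG.aestronglyMeasurable hm]
      exact hi
    have hM0 : 0 ≤ M := (norm_nonneg _).trans (hM 0)
    have hfd : Continuous (fderiv ℝ h) := hh.continuous_fderiv (by norm_num)
    have hhc := hh.continuous
    have hrec : ∀ u, R u + T u • c = u := fun u => by rw [hR]; abel
    have t1 := tr (fun p => h (p.1 + p.2 • c) * p.2) (by fun_prop) (by
      simp only [hrec]
      refine integrable_of_quadratic _ _ (by fun_prop) ((|h 0| + M) * ‖T‖) fun t => ?_
      have h1 := abs_le_of_fderiv_bound h hh M hM 0 t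
      rw [zero_add] at h1
      have h2 := T.le_opNorm t
      rw [Real.norm_eq_abs] at h2
      have h3 := norm_nonneg t
      have h4 := abs_nonneg (h 0)
      have h5 := norm_nonneg T
      rw [abs_mul]
      calc |h t| * |T t| ≤ (|h 0| + M * ‖t‖) * (‖T‖ * ‖t‖) := by gcongr
        _ = ((|h 0| + M * ‖t‖) * ‖t‖) * ‖T‖ := by ring
        _ ≤ ((|h 0| + M) * (1 + ‖t‖) ^ 2) * ‖T‖ := by
          refine mul_le_mul_of_nonneg_right ?_ h5
          nlinarith [mul_nonneg h3 h4, mul_nonneg hM0 h3, mul_nonneg h4 (sq_nonneg ‖t‖)]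
        _ = _ := by ring)
    have t2 := tr (fun p => fderiv ℝ h (p.1 + p.2 • c) (A a)) (by fun_prop) (by
      simp only [hrec]
      refine integrable_of_quadratic _ _ (by fun_prop) (M * ‖A a‖) fun t => ?_
      have h1 := (fderiv ℝ h t).le_opNorm (A a)
      rw [Real.norm_eq_abs] at h1
      have h2 : ‖fderiv ℝ h t‖ * ‖A a‖ ≤ M * ‖A a‖ := by gcongr; exact hM t
      have h3 := norm_nonneg t
      have h4 : 0 ≤ M * ‖A a‖ := by positivity
      nlinarith [mul_nonneg h4 h3, mul_nonneg h4 (sq_nonneg ‖t‖)])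
    simp only [hrec] at t1 t2
    have e0 : ∫ y, h y * inner ℝ a y ∂ν = ∫ y, h y * T y ∂ν := rfl
    rw [e0, t1, t2]
    congr 1; ext r
    have hder : ∀ t : ℝ, HasDerivAt (fun t : ℝ => h (r + t • c)) (fderiv ℝ h (r + t • c) c) t := by
      intro t
      have hd : HasFDerivAt h (fderiv ℝ h (r + t • c)) (r + t • c) :=
        (hh.differentiable (by norm_num)).differentiableAt.hasFDerivAt
      have hl : HasDerivAt (fun t : ℝ => r + t • c) c t := by
        simpa using ((hasDerivAt_id t).smul_const c).const_add r
      exact hd.comp_hasDerivAt t hl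
    have := stein_real s.toNNReal _ _ hder (by fun_prop) (M * ‖c‖) (fun t => by
      have h1 := (fderiv ℝ h (r + t • c)).le_opNorm c
      rw [Real.norm_eq_abs] at h1
      exact h1.trans (by gcongr; exact hM _))
    rw [this, ← integral_const_mul]
    congr 1; ext t
    rw [Real.coe_toNNReal _ hs0, ← smul_eq_mul, ← map_smul, hc, smul_inv_smul₀ hs]

open ProbabilityTheory in
/-- Derivative of the interpolation along rotations. -/
lemma interp_hasDerivAt {E : Type*} [NormedAddCommGroup E] [InnerProductSpace ℝ E]
    [MeasurableSpace E] [BorelSpace E] [SecondCountableTopology E] [CompleteSpace E]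
    (ν : Measure E) [IsGaussian ν] (h0 : ∫ x, x ∂ν = 0) (A : E →L[ℝ] E)
    (hA : ∀ x y : E, cov[fun u => inner ℝ x u, fun u => inner ℝ y u; ν] = inner ℝ x (A y))
    (f g : E → ℝ) (hf : ContDiff ℝ 1 f) (hg : ContDiff ℝ 1 g)
    (M N : ℝ) (hM : ∀ y, ‖fderiv ℝ f y‖ ≤ M) (hN : ∀ y, ‖fderiv ℝ g y‖ ≤ N)
    (G : E → E) (hG : Continuous G) (hGg : ∀ x v, fderiv ℝ g x v = inner ℝ (G x) v)
    (hGN : ∀ x, ‖G x‖ ≤ N) (θ : ℝ) :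
    HasDerivAt (fun θ : ℝ => ∫ p : E × E,
        f p.1 * g (Real.cos θ • p.1 + Real.sin θ • p.2) ∂(ν.prod ν))
      ((∫ p : E × E, fderiv ℝ f (Real.cos θ • p.1 - Real.sin θ • p.2) (A (G p.1)) ∂(ν.prod ν))
        * (- Real.sin θ)) θ := by
  have hM0 : 0 ≤ M := (norm_nonneg _).trans (hM 0)
  have hN0 : 0 ≤ N := (norm_nonneg _).trans (hN 0)
  have hfc := hf.continuous
  have hgc := hg.continuous
  have hfd : Continuous (fderiv ℝ f) := hf.continuous_fderiv (by norm_num)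
  have hgd : Continuous (fderiv ℝ g) := hg.continuous_fderiv (by norm_num)
  have hflin : ∀ x, |f x| ≤ |f 0| + M * ‖x‖ := fun x => by
    simpa using abs_le_of_fderiv_bound f hf M hM 0 x
  have hglin : ∀ x, |g x| ≤ |g 0| + N * ‖x‖ := fun x => by
    simpa using abs_le_of_fderiv_bound g hg N hN 0 x
  have hf0 := abs_nonneg (f 0)
  have hg0 := abs_nonneg (g 0)
  -- norms of rotated points
  have hrot : ∀ (c s : ℝ), |c| ≤ 1 → |s| ≤ 1 → ∀ p : E × E,
      ‖c • p.1 + s • p.2‖ ≤ 2 * ‖p‖ := by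
    intro c s hc hs p
    have h1 := norm_fst_le p
    have h2 := norm_snd_le p
    have h3 := norm_nonneg p.1
    have h4 := norm_nonneg p.2
    calc ‖c • p.1 + s • p.2‖ ≤ ‖c • p.1‖ + ‖s • p.2‖ := norm_add_le _ _
      _ = |c| * ‖p.1‖ + |s| * ‖p.2‖ := by rw [norm_smul, norm_smul, Real.norm_eq_abs, Real.norm_eq_abs]
      _ ≤ 1 * ‖p.1‖ + 1 * ‖p.2‖ := by gcongr
      _ ≤ 2 * ‖p‖ := by linarith
  have hquad : ∀ a b c d t : ℝ, 0 ≤ a → 0 ≤ b → 0 ≤ c → 0 ≤ d → 0 ≤ t →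
      (a + b * t) * (c + d * t) ≤ ((a + b) * (c + d)) * (1 + t) ^ 2 := by
    intro a b c d t ha hb hc hd ht
    have h1 : a + b * t ≤ (a + b) * (1 + t) := by nlinarith [mul_nonneg ha ht]
    have h2 : c + d * t ≤ (c + d) * (1 + t) := by nlinarith [mul_nonneg hc ht]
    calc (a + b * t) * (c + d * t) ≤ ((a + b) * (1 + t)) * ((c + d) * (1 + t)) := by
          gcongr
      _ = _ := by ring
  let F' : ℝ → E × E → ℝ := fun θ p => f p.1 * fderiv ℝ g (Real.cos θ • p.1 + Real.sin θ • p.2)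
      (-Real.sin θ • p.1 + Real.cos θ • p.2)
  have hD := (hasDerivAt_integral_of_dominated_loc_of_deriv_le (μ := ν.prod ν) (x₀ := θ)
    (s := Set.univ) (F := fun θ p => f p.1 * g (Real.cos θ • p.1 + Real.sin θ • p.2))
    (F' := F') (bound := fun p => ((|f 0| + M) * (0 + 2 * N)) * (1 + ‖p‖) ^ 2)
    Filter.univ_mem
    (Filter.Eventually.of_forall fun θ => by
      apply Continuous.aestronglyMeasurable; fun_prop)
    (by
      refine integrable_of_quadratic _ _ (by fun_prop) ((|f 0| + M) * (|g 0| + 2 * N)) fun p => ?_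
      rw [abs_mul]
      refine le_trans ?_ (hquad _ _ _ _ ‖p‖ hf0 hM0 hg0 (by positivity) (norm_nonneg p))
      have h1 := (hflin p.1).trans (add_le_add_right (mul_le_mul_of_nonneg_left (norm_fst_le p) hM0) _)
      have h2 := (hglin (Real.cos θ • p.1 + Real.sin θ • p.2)).trans
        (add_le_add_right (mul_le_mul_of_nonneg_left
          (hrot _ _ (Real.abs_cos_le_one θ) (Real.abs_sin_le_one θ) p) hN0) _)
      calc _ ≤ (|f 0| + M * ‖p‖) * (|g 0| + N * (2 * ‖p‖)) := by gcongr
        _ = _ := by ring)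
    (by apply Continuous.aestronglyMeasurable; fun_prop)
    (Filter.Eventually.of_forall fun p θ _ => by
      rw [Real.norm_eq_abs]
      simp only [F']
      rw [abs_mul]
      refine le_trans ?_ (hquad _ _ _ _ ‖p‖ hf0 hM0 le_rfl (by positivity) (norm_nonneg p))
      have h1 := (hflin p.1).trans (add_le_add_right (mul_le_mul_of_nonneg_left (norm_fst_le p) hM0) _)
      have h2 := (fderiv ℝ g (Real.cos θ • p.1 + Real.sin θ • p.2)).le_opNorm
        (-Real.sin θ • p.1 + Real.cos θ • p.2)
      have h3 := hrot (-Real.sin θ) (Real.cos θ) (by rw [abs_neg]; exact Real.abs_sin_le_one θ)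
        (Real.abs_cos_le_one θ) p
      have h4 := h2.trans (mul_le_mul (hN _) h3 (norm_nonneg _) hN0)
      rw [Real.norm_eq_abs] at h4
      calc _ ≤ (|f 0| + M * ‖p‖) * (N * (2 * ‖p‖)) := by gcongr
        _ = _ := by ring)
    (integrable_of_quadratic _ _ (by fun_prop) ((|f 0| + M) * (0 + 2 * N)) fun p => by
      rw [abs_of_nonneg (by positivity)])
    (Filter.Eventually.of_forall fun p θ _ => by
      have hd : HasFDerivAt g (fderiv ℝ g (Real.cos θ • p.1 + Real.sin θ • p.2))
          (Real.cos θ • p.1 + Real.sin θ • p.2) :=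
        (hg.differentiable (by norm_num)).differentiableAt.hasFDerivAt
      have hl : HasDerivAt (fun θ : ℝ => Real.cos θ • p.1 + Real.sin θ • p.2)
          (-Real.sin θ • p.1 + Real.cos θ • p.2) θ :=
        ((Real.hasDerivAt_cos θ).smul_const p.1).add ((Real.hasDerivAt_sin θ).smul_const p.2)
      exact (hd.comp_hasDerivAt θ hl).const_mul (f p.1))).2
  refine hD.congr_deriv ?_
  -- rotate
  let K : E × E → ℝ := fun p =>
    f (Real.cos θ • p.1 - Real.sin θ • p.2) * inner ℝ (G p.1) p.2
  have hK : Continuous K := by fun_prop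
  have e1 : ∀ p, F' θ p = K (ContinuousLinearMap.rotation θ p) := by
    intro p
    simp only [F', K, ContinuousLinearMap.rotation_apply, hGg]
    congr 2
    have := Real.sin_sq_add_cos_sq θ
    simp only [smul_add, smul_smul]
    have h1 : p.1 = (Real.cos θ * Real.cos θ + Real.sin θ * Real.sin θ) • p.1 := by
      rw [show Real.cos θ * Real.cos θ + Real.sin θ * Real.sin θ = 1 by linarith [this], one_smul]
    conv_lhs => rw [h1]
    module
  have hpres := IsGaussian.map_rotation_eq_self (μ := ν) (by simpa using h0) θ
  have e2 : ∫ p, F' θ p ∂(ν.prod ν) = ∫ p, K p ∂(ν.prod ν) := by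
    simp only [e1]
    rw [← integral_map (f := K) (ContinuousLinearMap.rotation θ).continuous.aemeasurable
      hK.aestronglyMeasurable, hpres]
  have hrot' : ∀ p : E × E, ‖Real.cos θ • p.1 - Real.sin θ • p.2‖ ≤ 2 * ‖p‖ := fun p => by
    have := hrot (Real.cos θ) (-Real.sin θ) (Real.abs_cos_le_one θ)
      (by rw [abs_neg]; exact Real.abs_sin_le_one θ) p
    rwa [neg_smul, ← sub_eq_add_neg] at this
  have iK : Integrable K (ν.prod ν) := by
    refine integrable_of_quadratic _ _ hK ((|f 0| + 2 * M) * (0 + N)) fun p => ?_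
    refine le_trans ?_ (hquad _ _ _ _ ‖p‖ hf0 (by positivity) le_rfl hN0 (norm_nonneg p))
    simp only [K]
    rw [abs_mul]
    have h1 := (hflin (Real.cos θ • p.1 - Real.sin θ • p.2)).trans
        (add_le_add_right (mul_le_mul_of_nonneg_left (hrot' p) hM0) _)
    have h2 := (abs_real_inner_le_norm (G p.1) p.2).trans
      (mul_le_mul (hGN _) (norm_snd_le p) (norm_nonneg _) hN0)
    calc _ ≤ (|f 0| + M * (2 * ‖p‖)) * (N * ‖p‖) := by gcongr
        _ = _ := by ring
  have iH : Integrable (fun p : E × E =>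
      fderiv ℝ f (Real.cos θ • p.1 - Real.sin θ • p.2) (A (G p.1))) (ν.prod ν) := by
    refine integrable_of_quadratic _ _ (by fun_prop) (M * (‖A‖ * N)) fun p => ?_
    have h1 := (fderiv ℝ f (Real.cos θ • p.1 - Real.sin θ • p.2)).le_opNorm (A (G p.1))
    have h2 : ‖A (G p.1)‖ ≤ ‖A‖ * N := (A.le_opNorm _).trans (by gcongr; exact hGN _)
    have h3 := h1.trans (mul_le_mul (hM _) h2 (norm_nonneg _) hM0)
    rw [Real.norm_eq_abs] at h3
    have h4 : 0 ≤ M * (‖A‖ * N) := by positivity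
    have h5 := norm_nonneg p
    nlinarith [mul_nonneg h4 h5, mul_nonneg h4 (sq_nonneg ‖p‖)]
  rw [e2, integral_prod _ iK, integral_prod _ iH, ← integral_mul_const]
  congr 1; ext x
  rw [← integral_mul_const]
  have hder : ∀ y, HasFDerivAt (fun y => f (Real.cos θ • x - Real.sin θ • y))
      ((fderiv ℝ f (Real.cos θ • x - Real.sin θ • y)).comp
        (-(Real.sin θ • ContinuousLinearMap.id ℝ E))) y := by
    intro y
    have hd : HasFDerivAt f (fderiv ℝ f (Real.cos θ • x - Real.sin θ • y))
          (Real.cos θ • x - Real.sin θ • y) :=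
        (hf.differentiable (by norm_num)).differentiableAt.hasFDerivAt
    exact hd.comp y (((hasFDerivAt_id y).const_smul (Real.sin θ)).const_sub _)
  have hst := stein_gaussian ν h0 A hA (fun y => f (Real.cos θ • x - Real.sin θ • y))
    (by fun_prop) M (fun y => by
      rw [(hder y).fderiv]
      refine (ContinuousLinearMap.opNorm_comp_le _ _).trans ?_
      have h1 : ‖-(Real.sin θ • ContinuousLinearMap.id ℝ E)‖ ≤ 1 := by
        rw [norm_neg, norm_smul, Real.norm_eq_abs]
        calc _ ≤ 1 * 1 := mul_le_mul (Real.abs_sin_le_one θ) ContinuousLinearMap.norm_id_le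
              (norm_nonneg _) zero_le_one
          _ = 1 := one_mul 1
      calc _ ≤ M * 1 := mul_le_mul (hM _) h1 (norm_nonneg _) hM0
        _ = M := mul_one M) (G x)
  simp only [K]
  rw [hst]
  congr 1; ext y
  rw [(hder y).fderiv]
  simp [mul_comm]

open ProbabilityTheory in
/-- Covariance representation for a centered Gaussian measure, explicit coupling. -/
lemma interp_cov {E : Type*} [NormedAddCommGroup E] [InnerProductSpace ℝ E]
    [MeasurableSpace E] [BorelSpace E] [SecondCountableTopology E] [CompleteSpace E]
    (ν : Measure E) [IsGaussian ν] (h0 : ∫ x, x ∂ν = 0) (A : E →L[ℝ] E)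
    (hA : ∀ x y : E, cov[fun u => inner ℝ x u, fun u => inner ℝ y u; ν] = inner ℝ x (A y))
    (f g : E → ℝ) (hf : ContDiff ℝ 1 f) (hg : ContDiff ℝ 1 g)
    (M N : ℝ) (hM : ∀ y, ‖fderiv ℝ f y‖ ≤ M) (hN : ∀ y, ‖fderiv ℝ g y‖ ≤ N)
    (G : E → E) (hG : Continuous G) (hGg : ∀ x v, fderiv ℝ g x v = inner ℝ (G x) v)
    (hGN : ∀ x, ‖G x‖ ≤ N) :
    (∫ x, f x * g x ∂ν) - (∫ x, f x ∂ν) * (∫ x, g x ∂ν) =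
      ∫ α in (0 : ℝ)..1, ∫ p : E × E,
        fderiv ℝ f (α • p.1 - √(1 - α ^ 2) • p.2) (A (G p.1)) ∂(ν.prod ν) := by
  have hM0 : 0 ≤ M := (norm_nonneg _).trans (hM 0)
  have hfd : Continuous (fderiv ℝ f) := hf.continuous_fderiv (by norm_num)
  set ψ : ℝ → ℝ := fun α => ∫ p : E × E,
        fderiv ℝ f (α • p.1 - √(1 - α ^ 2) • p.2) (A (G p.1)) ∂(ν.prod ν) with hψ
  have hψc : Continuous ψ := by
    refine continuous_of_dominated (bound := fun _ => M * (‖A‖ * N)) (fun α => ?_) (fun α => ?_)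
      (integrable_const _) (Filter.Eventually.of_forall fun p => ?_)
    · apply Continuous.aestronglyMeasurable; fun_prop
    · refine Filter.Eventually.of_forall fun p => ?_
      have h1 := (fderiv ℝ f (α • p.1 - √(1 - α ^ 2) • p.2)).le_opNorm (A (G p.1))
      have h2 : ‖A (G p.1)‖ ≤ ‖A‖ * N := (A.le_opNorm _).trans (by gcongr; exact hGN _)
      exact h1.trans (mul_le_mul (hM _) h2 (norm_nonneg _) hM0)
    · fun_prop
  have hpi : (0 : ℝ) ≤ Real.pi / 2 := by positivity
  have hsub := intervalIntegral.integral_comp_mul_deriv (a := 0) (b := Real.pi / 2)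
    (f := Real.cos) (f' := fun θ => -Real.sin θ) (g := ψ)
    (fun θ _ => Real.hasDerivAt_cos θ) (by fun_prop) hψc
  have hftc := intervalIntegral.integral_eq_sub_of_hasDerivAt (a := 0) (b := Real.pi / 2)
    (f := fun θ : ℝ => ∫ p : E × E,
        f p.1 * g (Real.cos θ • p.1 + Real.sin θ • p.2) ∂(ν.prod ν))
    (f' := fun θ => (ψ ∘ Real.cos) θ * (-Real.sin θ))
    (fun θ hθ => by
      rw [Set.uIcc_of_le hpi] at hθ
      refine (interp_hasDerivAt ν h0 A hA f g hf hg M N hM hN G hG hGg hGN θ).congr_deriv ?_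
      have hs : √(1 - Real.cos θ ^ 2) = Real.sin θ := by
        rw [← Real.sin_sq, Real.sqrt_sq (Real.sin_nonneg_of_nonneg_of_le_pi hθ.1 (by linarith [hθ.2]))]
      simp only [hψ, Function.comp, hs])
    (by
      apply Continuous.intervalIntegrable
      have := Real.continuous_cos
      have := Real.continuous_sin
      fun_prop)
  rw [hsub] at hftc
  simp only [Real.cos_zero, Real.sin_zero, Real.cos_pi_div_two, Real.sin_pi_div_two, one_smul,
    zero_smul, add_zero, zero_add] at hftc
  rw [intervalIntegral.integral_symm, integral_prod_mul (fun x => f x) (fun y => g y)] at hftc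
  have e : ∫ p : E × E, f p.1 * g p.1 ∂(ν.prod ν) = ∫ x, f x * g x ∂ν := by
    rw [integral_fun_fst (f := fun x => f x * g x)]
    simp
  rw [e] at hftc
  linarith

open Matrix in
lemma dotProduct_mulVec_eq_sum {d : ℕ} (S : Matrix (Fin d) (Fin d) ℝ)
    (x y : EuclideanSpace ℝ (Fin d)) :
    x.ofLp ⬝ᵥ S *ᵥ y.ofLp = ∑ i, ∑ j, S i j * x i * y j := by
  simp only [dotProduct, mulVec, Finset.mul_sum]
  refine Finset.sum_congr rfl fun i _ => Finset.sum_congr rfl fun j _ => by ring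

lemma inner_eq_sum_coord {d : ℕ} (x y : EuclideanSpace ℝ (Fin d)) :
    inner ℝ x y = ∑ i, x i * y i := by
  simp [PiLp.inner_apply, mul_comm]

open ProbabilityTheory in
lemma multivariateGaussian_eq_map {d : ℕ} (m : EuclideanSpace ℝ (Fin d))
    (S : Matrix (Fin d) (Fin d) ℝ) :
    multivariateGaussian m S = (multivariateGaussian 0 S).map (fun x => m + x) := by
  rw [multivariateGaussian, multivariateGaussian, Measure.map_map (by fun_prop) (by fun_prop)]
  congr 1
  ext x
  simp [Function.comp]

open ProbabilityTheory in
lemma gaussian_unique {d : ℕ} (P : Measure (EuclideanSpace ℝ (Fin d)))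
    (m : EuclideanSpace ℝ (Fin d)) (S : Matrix (Fin d) (Fin d) ℝ)
    (hP : IsGaussianMeasure P m S) (hpsd : S.PosSemidef) :
    P = (multivariateGaussian 0 S).map (fun x => m + x) := by
  rw [← multivariateGaussian_eq_map]
  obtain ⟨h1, h2⟩ := hP
  apply Measure.ext_of_charFun
  ext t
  rw [charFun_multivariateGaussian hpsd, charFun_apply]
  have h3 := h2 t
  have e1 : ∀ x : EuclideanSpace ℝ (Fin d),
      Complex.exp ((inner ℝ x t : ℝ) * Complex.I) =
      Complex.exp (Complex.I * ((∑ i, t i * x i : ℝ) : ℂ)) := by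
    intro x
    rw [real_inner_comm, inner_eq_sum_coord, mul_comm]
  simp only [e1]
  rw [h3, dotProduct_mulVec_eq_sum, real_inner_comm, inner_eq_sum_coord, mul_comm Complex.I]

open ProbabilityTheory Matrix in
lemma joint_unique {d : ℕ} (Q : Measure (EuclideanSpace ℝ (Fin d) × EuclideanSpace ℝ (Fin d)))
    (m : EuclideanSpace ℝ (Fin d)) (S : Matrix (Fin d) (Fin d) ℝ) (α β : ℝ)
    (hQ : IsJointGaussianMeasure Q m S α) (hS : S.IsSymm) (hpsd : S.PosSemidef)
    (hαβ : α ^ 2 + β ^ 2 = 1) :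
    Q = ((multivariateGaussian 0 S).prod (multivariateGaussian 0 S)).map
      (fun p => (m + (α • p.1 - β • p.2), m + p.1)) := by
  obtain ⟨h1, h2⟩ := hQ
  set ν := multivariateGaussian (0 : EuclideanSpace ℝ (Fin d)) S with hν
  have hmeas : Measurable (fun p : EuclideanSpace ℝ (Fin d) × EuclideanSpace ℝ (Fin d) =>
      (m + (α • p.1 - β • p.2), m + p.1)) := by fun_prop
  have : IsProbabilityMeasure ((ν.prod ν).map
      (fun p => (m + (α • p.1 - β • p.2), m + p.1))) :=
    Measure.isProbabilityMeasure_map hmeas.aemeasurable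
  apply Measure.ext_of_charFunDual
  ext L
  set t := (InnerProductSpace.toDual ℝ _).symm (L.comp (.inl ℝ _ _)) with ht
  set s := (InnerProductSpace.toDual ℝ _).symm (L.comp (.inr ℝ _ _)) with hs
  have hL : ∀ p, L p = inner ℝ t p.1 + inner ℝ s p.2 := by
    intro p
    rw [ht, hs, InnerProductSpace.toDual_symm_apply, InnerProductSpace.toDual_symm_apply,
      L.comp_inl_add_comp_inr]
  rw [charFunDual_apply, charFunDual_apply, integral_map hmeas.aemeasurable
    (by apply Continuous.aestronglyMeasurable; fun_prop)]
  have e1 : ∀ p, Complex.exp ((L p : ℝ) * Complex.I) = Complex.exp (Complex.I *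
      ((∑ i, t i * p.1 i + ∑ i, s i * p.2 i : ℝ) : ℂ)) := by
    intro p
    rw [hL, inner_eq_sum_coord, inner_eq_sum_coord, mul_comm]
  have e2 : ∀ p : EuclideanSpace ℝ (Fin d) × EuclideanSpace ℝ (Fin d),
      Complex.exp ((L (m + (α • p.1 - β • p.2), m + p.1) : ℝ) * Complex.I) =
      Complex.exp ((inner ℝ m (t + s) : ℝ) * Complex.I) *
        (Complex.exp ((inner ℝ p.1 (α • t + s) : ℝ) * Complex.I) *
         Complex.exp ((inner ℝ p.2 (-β • t) : ℝ) * Complex.I)) := by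
    intro p
    rw [← Complex.exp_add, ← Complex.exp_add, hL]
    congr 1
    simp only [inner_add_right, inner_sub_right, inner_smul_right, real_inner_comm t,
      real_inner_comm s]
    push_cast
    ring
  simp only [e2]
  simp only [e1]
  rw [h2, integral_const_mul, integral_prod_mul
    (fun x => Complex.exp ((inner ℝ x (α • t + s) : ℝ) * Complex.I))
    (fun x => Complex.exp ((inner ℝ x (-β • t) : ℝ) * Complex.I)),
    ← charFun_apply, ← charFun_apply, hν, charFun_multivariateGaussian hpsd,
    charFun_multivariateGaussian hpsd, ← Complex.exp_add, ← Complex.exp_add]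
  congr 1
  have hsym : s.ofLp ⬝ᵥ S *ᵥ t.ofLp = t.ofLp ⬝ᵥ S *ᵥ s.ofLp := by
    rw [dotProduct_mulVec, ← mulVec_transpose, hS.eq, dotProduct_comm]
  have hq : ((α • t + s).ofLp ⬝ᵥ S *ᵥ (α • t + s).ofLp) + ((-β • t).ofLp ⬝ᵥ S *ᵥ (-β • t).ofLp)
      = t.ofLp ⬝ᵥ S *ᵥ t.ofLp + s.ofLp ⬝ᵥ S *ᵥ s.ofLp + 2 * α * (t.ofLp ⬝ᵥ S *ᵥ s.ofLp) := by
    simp only [WithLp.ofLp_add, WithLp.ofLp_smul, mulVec_add, mulVec_smul, dotProduct_add,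
      add_dotProduct, smul_dotProduct, dotProduct_smul, smul_eq_mul, hsym]
    linear_combination (t.ofLp ⬝ᵥ S *ᵥ t.ofLp) * hαβ
  rw [← dotProduct_mulVec_eq_sum, ← dotProduct_mulVec_eq_sum, ← dotProduct_mulVec_eq_sum, ← hq,
    inner_eq_sum_coord m]
  simp only [inner_zero_right, PiLp.add_apply]
  push_cast
  ring

/-- The interpolation covariance representation:
`Cov(f(X), g(X)) = ∫₀¹ E⟨Σ∇f(X_α), ∇g(Y_α)⟩ dα` for `f, g` C¹ with bounded gradients. -/
theorem stmt2 {d : ℕ} (P : Measure (EuclideanSpace ℝ (Fin d)))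
    (m : EuclideanSpace ℝ (Fin d)) (S : Matrix (Fin d) (Fin d) ℝ)
    (hP : IsGaussianMeasure P m S) (hS : S.IsSymm) (hpsd : S.PosSemidef)
    (Q : ℝ → Measure (EuclideanSpace ℝ (Fin d) × EuclideanSpace ℝ (Fin d)))
    (hQ : ∀ α ∈ Set.Icc (0 : ℝ) 1, IsJointGaussianMeasure (Q α) m S α)
    (f g : EuclideanSpace ℝ (Fin d) → ℝ)
    (hf : ContDiff ℝ 1 f) (hg : ContDiff ℝ 1 g)
    (hf' : ∃ M : ℝ, ∀ y, ‖gradient f y‖ ≤ M) (hg' : ∃ M : ℝ, ∀ y, ‖gradient g y‖ ≤ M) :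
    (∫ y, f y * g y ∂P) - (∫ y, f y ∂P) * (∫ y, g y ∂P) =
      ∫ α in (0 : ℝ)..1,
        ∫ p, ∑ i, ∑ j, S i j * gradient f p.1 j * gradient g p.2 i ∂(Q α) := by
  obtain ⟨M, hM⟩ := hf'
  obtain ⟨N, hN⟩ := hg'
  set ν := ProbabilityTheory.multivariateGaussian (0 : EuclideanSpace ℝ (Fin d)) S with hν
  have hPν : P = ν.map (fun x => m + x) := gaussian_unique P m S hP hpsd
  let A : EuclideanSpace ℝ (Fin d) →L[ℝ] EuclideanSpace ℝ (Fin d) :=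
    Matrix.toEuclideanCLM (𝕜 := ℝ) S
  have hAx : ∀ x i, A x i = ∑ j, S i j * x j := by
    intro x i
    simp [A, Matrix.ofLp_toEuclideanCLM, Matrix.mulVec, dotProduct]
  have hA : ∀ x y : EuclideanSpace ℝ (Fin d),
      ProbabilityTheory.covariance (fun u => inner ℝ x u) (fun u => inner ℝ y u) ν
        = inner ℝ x (A y) := by
    intro x y
    rw [← ProbabilityTheory.covarianceBilin_apply_eq_cov
      ProbabilityTheory.IsGaussian.memLp_two_id,
      ProbabilityTheory.covarianceBilin_multivariateGaussian hpsd, dotProduct_mulVec_eq_sum,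
      inner_eq_sum_coord]
    refine Finset.sum_congr rfl fun i _ => ?_
    rw [hAx, Finset.mul_sum]
    exact Finset.sum_congr rfl fun j _ => by ring
  have hgrad : ∀ (h : EuclideanSpace ℝ (Fin d) → ℝ) x v,
      fderiv ℝ h x v = inner ℝ (gradient h x) v := by
    intro h x v
    rw [gradient, InnerProductSpace.toDual_symm_apply]
  have hgradn : ∀ (h : EuclideanSpace ℝ (Fin d) → ℝ) x, ‖fderiv ℝ h x‖ = ‖gradient h x‖ := by
    intro h x
    rw [gradient, LinearIsometryEquiv.norm_map]
  have hgfd : Continuous (fderiv ℝ g) := hg.continuous_fderiv (by norm_num)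
  have hffd : Continuous (fderiv ℝ f) := hf.continuous_fderiv (by norm_num)
  have hgc : Continuous (gradient g) :=
    (InnerProductSpace.toDual ℝ (EuclideanSpace ℝ (Fin d))).symm.continuous.comp hgfd
  have key := interp_cov ν (by simp [hν]) A hA (fun x => f (m + x)) (fun x => g (m + x))
    (by fun_prop) (by fun_prop) M N
    (fun y => by rw [fderiv_comp_add_left, hgradn]; exact hM _)
    (fun y => by rw [fderiv_comp_add_left, hgradn]; exact hN _)
    (fun x => gradient g (m + x)) (by fun_prop)
    (fun x v => by rw [fderiv_comp_add_left, hgrad])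
    (fun x => hN _)
  have hmm : AEMeasurable (fun x : EuclideanSpace ℝ (Fin d) => m + x) ν := by fun_prop
  have hfc := hf.continuous
  have hgc' := hg.continuous
  rw [hPν, integral_map (f := fun y => f y * g y) hmm (hfc.mul hgc').aestronglyMeasurable,
    integral_map hmm hfc.aestronglyMeasurable, integral_map hmm hgc'.aestronglyMeasurable, key]
  apply intervalIntegral.integral_congr
  intro α hα
  rw [Set.uIcc_of_le zero_le_one] at hα
  have hb : α ^ 2 + √(1 - α ^ 2) ^ 2 = 1 := by
    rw [Real.sq_sqrt (by nlinarith [hα.1, hα.2])]; ring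
  have hsum : ∀ p : EuclideanSpace ℝ (Fin d) × EuclideanSpace ℝ (Fin d),
      ∑ i, ∑ j, S i j * gradient f p.1 j * gradient g p.2 i
        = fderiv ℝ f p.1 (A (gradient g p.2)) := by
    intro p
    rw [hgrad, inner_eq_sum_coord, Finset.sum_comm]
    refine Finset.sum_congr rfl fun j _ => ?_
    rw [hAx, Finset.mul_sum]
    refine Finset.sum_congr rfl fun i _ => ?_
    rw [hS.apply i j]
    ring
  simp only [hsum]
  rw [joint_unique (Q α) m S α _ (hQ α hα) hS hpsd hb, integral_map
    (Measurable.aemeasurable (by fun_prop))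
    (by apply Continuous.aestronglyMeasurable; fun_prop)]
  simp only [fderiv_comp_add_left]
  rfl
end

section
/- If X ~ N(μ, Σ) on ℝ^d, then for all x > 0, P(max_i X_i - E[max_i X_i] ≥ x) ≤ exp(-x²/(2σ*²)), where σ*² = max_{1≤i≤d} Var(X_i) = max_i Σ_{ii}. -/
open MeasureTheory Finset

lemma exp_third (y : ℝ) : Real.exp y ≤ 1 + y + y ^ 2 / 2 + |y| ^ 3 * Real.exp |y| := by
  have h := Complex.norm_exp_sub_sum_le_norm_mul_exp (y : ℂ) 3
  have e : Complex.exp (y:ℂ) - ∑ m ∈ Finset.range 3, (y:ℂ) ^ m / (m.factorial : ℂ)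
      = ((Real.exp y - (1 + y + y^2/2) : ℝ) : ℂ) := by
    simp [Finset.sum_range_succ, Nat.factorial]
  rw [e, Complex.norm_real, Complex.norm_real, Real.norm_eq_abs, Real.norm_eq_abs] at h
  linarith [le_abs_self (Real.exp y - (1 + y + y^2/2))]

/-- Lipschitz functions with a convex-weight gradient and quadratic remainder. -/
structure Nice {d : ℕ} (C : ℝ) (g : EuclideanSpace ℝ (Fin d) → ℝ)
    (q : EuclideanSpace ℝ (Fin d) → Fin d → ℝ) : Prop where
  lip : ∀ x u, |g (x + u) - g x| ≤ ‖u‖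
  nonneg : ∀ x i, 0 ≤ q x i
  sum_one : ∀ x, ∑ i, q x i = 1
  quad : ∀ x u, |g (x + u) - g x - ∑ i, q x i * u i| ≤ C * ‖u‖ ^ 2

lemma coord_le {d : ℕ} (u : EuclideanSpace ℝ (Fin d)) (i : Fin d) : |u i| ≤ ‖u‖ := by
  simpa using PiLp.norm_apply_le u i

lemma wsum_le {d : ℕ} (q : Fin d → ℝ) (h0 : ∀ i, 0 ≤ q i) (h1 : ∑ i, q i = 1)
    (u : EuclideanSpace ℝ (Fin d)) : |∑ i, q i * u i| ≤ ‖u‖ := by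
  calc |∑ i, q i * u i| ≤ ∑ i, |q i * u i| := Finset.abs_sum_le_sum_abs _ _
    _ ≤ ∑ i, q i * ‖u‖ := by
        apply Finset.sum_le_sum; intro i _
        rw [abs_mul, abs_of_nonneg (h0 i)]
        exact mul_le_mul_of_nonneg_left (coord_le u i) (h0 i)
    _ = ‖u‖ := by rw [← Finset.sum_mul, h1, one_mul]

lemma wsum_sq_le {d : ℕ} (q : Fin d → ℝ) (h0 : ∀ i, 0 ≤ q i) (h1 : ∑ i, q i = 1)
    (u : EuclideanSpace ℝ (Fin d)) : (∑ i, q i * u i) ^ 2 ≤ ∑ i, q i * u i ^ 2 :=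
  Real.pow_arith_mean_le_arith_mean_pow_of_even Finset.univ q u (fun i _ => h0 i) h1 even_two

lemma Nice.cont {d : ℕ} {C : ℝ} {g : EuclideanSpace ℝ (Fin d) → ℝ}
    {q : EuclideanSpace ℝ (Fin d) → Fin d → ℝ} (h : Nice C g q) : Continuous g := by
  have : LipschitzWith 1 g := by
    apply LipschitzWith.of_dist_le_mul
    intro x y
    have := h.lip y (x - y)
    simpa [Real.dist_eq, dist_eq_norm] using this
  exact this.continuous

/-- partition function -/
noncomputable def Zf {d : ℕ} (b : ℝ) (x : EuclideanSpace ℝ (Fin d)) : ℝ := ∑ i, Real.exp (b * x i)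
noncomputable def lse {d : ℕ} (b : ℝ) (x : EuclideanSpace ℝ (Fin d)) : ℝ := Real.log (Zf b x) / b
noncomputable def smax {d : ℕ} (b : ℝ) (x : EuclideanSpace ℝ (Fin d)) (i : Fin d) : ℝ :=
  Real.exp (b * x i) / Zf b x

lemma Zf_pos {d : ℕ} (hd : 0 < d) (b : ℝ) (x : EuclideanSpace ℝ (Fin d)) : 0 < Zf b x := by
  have : Nonempty (Fin d) := Fin.pos_iff_nonempty.mp hd
  exact Finset.sum_pos (fun i _ => Real.exp_pos _) Finset.univ_nonempty

lemma exp_lse {d : ℕ} (hd : 0 < d) {b : ℝ} (hb : 0 < b) (x : EuclideanSpace ℝ (Fin d)) :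
    Real.exp (b * lse b x) = Zf b x := by
  rw [lse, mul_div_cancel₀ _ hb.ne', Real.exp_log (Zf_pos hd b x)]

lemma smax_cont {d : ℕ} (hd : 0 < d) (b : ℝ) (i : Fin d) :
    Continuous (fun x : EuclideanSpace ℝ (Fin d) => smax b x i) := by
  unfold smax
  apply Continuous.div
  · fun_prop
  · unfold Zf; fun_prop
  · intro x; exact (Zf_pos hd b x).ne'

lemma lse_lip1 {d : ℕ} (hd : 0 < d) {b : ℝ} (hb : 0 < b) (x u : EuclideanSpace ℝ (Fin d)) :
    lse b (x + u) ≤ lse b x + ‖u‖ := by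
  have : Real.exp (b * lse b (x+u)) ≤ Real.exp (b * (lse b x + ‖u‖)) := by
    rw [mul_add, Real.exp_add, exp_lse hd hb, exp_lse hd hb, Zf, Zf, Finset.sum_mul]
    apply Finset.sum_le_sum; intro i _
    rw [← Real.exp_add, Real.exp_le_exp, PiLp.add_apply, mul_add]
    have := (le_abs_self _).trans (coord_le u i)
    gcongr
  rw [Real.exp_le_exp] at this
  exact le_of_mul_le_mul_left this hb

lemma lse_nice {d : ℕ} (hd : 0 < d) {b : ℝ} (hb : 0 < b) :
    Nice (d := d) (4 * b) (lse b) (smax b) := by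
  have hlip : ∀ x u : EuclideanSpace ℝ (Fin d), |lse b (x + u) - lse b x| ≤ ‖u‖ := by
    intro x u
    rw [abs_le]
    have h1 := lse_lip1 hd hb x u
    have h2 := lse_lip1 hd hb (x+u) (-u)
    simp at h2
    constructor <;> linarith
  have h0 : ∀ (x : EuclideanSpace ℝ (Fin d)) i, 0 ≤ smax b x i := fun x i =>
    div_nonneg (Real.exp_pos _).le (Zf_pos hd b x).le
  have h1 : ∀ x : EuclideanSpace ℝ (Fin d), ∑ i, smax b x i = 1 := by
    intro x
    unfold smax
    rw [← Finset.sum_div]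
    exact div_self (Zf_pos hd b x).ne'
  refine ⟨hlip, h0, h1, ?_⟩
  intro x u
  set s := ∑ i, smax b x i * u i with hs
  have hsle : |s| ≤ ‖u‖ := wsum_le _ (h0 x) (h1 x) u
  have key : Real.exp (b * (lse b (x+u) - lse b x - s))
      = ∑ i, smax b x i * Real.exp (b * (u i - s)) := by
    rw [mul_sub, mul_sub, Real.exp_sub, Real.exp_sub, exp_lse hd hb, exp_lse hd hb]
    have hz := (Zf_pos hd b x).ne'
    rw [div_div, div_eq_iff (by positivity)]
    rw [Finset.sum_mul, Zf]
    apply Finset.sum_congr rfl; intro i _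
    rw [smax, PiLp.add_apply, mul_add, mul_sub, Real.exp_add, Real.exp_sub]
    field_simp
  have hmean : ∑ i, smax b x i * (1 + b * (u i - s)) = 1 := by
    have : ∀ i, smax b x i * (1 + b * (u i - s))
      = smax b x i * (1 - b * s) + b * (smax b x i * u i) := fun i => by ring
    simp_rw [this]
    rw [Finset.sum_add_distrib, ← Finset.sum_mul, ← Finset.mul_sum, h1, ← hs]; ring
  rw [abs_le]
  constructor
  · have : 1 ≤ Real.exp (b * (lse b (x+u) - lse b x - s)) := by
      rw [key, ← hmean]
      apply Finset.sum_le_sum; intro i _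
      apply mul_le_mul_of_nonneg_left _ (h0 x i)
      linarith [Real.add_one_le_exp (b * (u i - s))]
    have h2 : 0 ≤ b * (lse b (x+u) - lse b x - s) := by
      rwa [← Real.exp_le_exp, Real.exp_zero]
    have h3 := nonneg_of_mul_nonneg_right h2 hb
    have : 0 ≤ 4 * b * ‖u‖^2 := by positivity
    linarith
  · by_cases hu : b * (2 * ‖u‖) ≤ 1
    · have : Real.exp (b * (lse b (x+u) - lse b x - s)) ≤ 1 + 4 * b^2 * ‖u‖^2 := by
        rw [key]
        calc _ ≤ ∑ i, smax b x i * ((1 + b * (u i - s)) + 4 * b^2 * ‖u‖^2) := by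
              apply Finset.sum_le_sum; intro i _
              apply mul_le_mul_of_nonneg_left _ (h0 x i)
              have hw : |u i - s| ≤ 2 * ‖u‖ := by
                linarith [abs_sub (u i) s, coord_le u i]
              have hw' : |b * (u i - s)| ≤ b * (2 * ‖u‖) := by
                rw [abs_mul, abs_of_pos hb]; gcongr
              have h4 := Real.abs_exp_sub_one_sub_id_le (hw'.trans hu)
              have h5 : (b * (u i - s))^2 ≤ (b * (2*‖u‖))^2 := sq_le_sq' (by linarith [abs_le.mp hw']) (abs_le.mp hw').2
              have := (abs_le.mp h4).2
              nlinarith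
          _ = _ := by
              simp_rw [mul_add (smax b x _) (1 + _) _]
              rw [Finset.sum_add_distrib, hmean, ← Finset.sum_mul, h1, one_mul]
      have h2 := Real.add_one_le_exp (b * (lse b (x+u) - lse b x - s))
      have h3 : b * (lse b (x+u) - lse b x - s) ≤ b * (4 * b * ‖u‖^2) := by nlinarith
      exact le_of_mul_le_mul_left h3 hb
    · push Not at hu
      have := (abs_le.mp (hlip x u)).2
      have h2 := (abs_le.mp hsle).1
      nlinarith [norm_nonneg u]

lemma max_le_lse {d : ℕ} (hd : 0 < d) {b : ℝ} (hb : 0 < b) (x : EuclideanSpace ℝ (Fin d))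
   (hne : (Finset.univ : Finset (Fin d)).Nonempty) : Finset.univ.sup' hne x ≤ lse b x := by
  apply Finset.sup'_le
  intro i _
  have : Real.exp (b * x i) ≤ Real.exp (b * lse b x) := by
    rw [exp_lse hd hb]
    exact Finset.single_le_sum (f := fun i => Real.exp (b * x i)) (fun i _ => (Real.exp_pos _).le) (Finset.mem_univ i)
  exact le_of_mul_le_mul_left (Real.exp_le_exp.mp this) hb

lemma lse_le_max {d : ℕ} (hd : 0 < d) {b : ℝ} (hb : 0 < b) (x : EuclideanSpace ℝ (Fin d))
   (hne : (Finset.univ : Finset (Fin d)).Nonempty) :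
   lse b x ≤ Finset.univ.sup' hne x + Real.log d / b := by
  have hd' : (0:ℝ) < d := by exact_mod_cast hd
  have : Real.exp (b * lse b x) ≤ Real.exp (b * (Finset.univ.sup' hne x + Real.log d / b)) := by
    rw [exp_lse hd hb, mul_add, mul_div_cancel₀ _ hb.ne', Real.exp_add, Real.exp_log hd']
    calc Zf b x ≤ ∑ i : Fin d, Real.exp (b * Finset.univ.sup' hne x) := by
          apply Finset.sum_le_sum; intro i _
          have := Finset.le_sup' (f := x) (Finset.mem_univ i)
          rw [Real.exp_le_exp]; exact mul_le_mul_of_nonneg_left this hb.le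
      _ = _ := by simp [mul_comm]
  exact le_of_mul_le_mul_left (Real.exp_le_exp.mp this) hb

/-- Properties of a centered Gaussian measure used in the interpolation argument. -/
structure GM {d : ℕ} (γ : Measure (EuclideanSpace ℝ (Fin d))) (V : ℝ) : Prop where
  hexp : ∀ c : ℝ, Integrable (fun v => Real.exp (c * ‖v‖)) γ
  hrot : ∀ a b : ℝ, (γ.map (a • ·)) ∗ (γ.map (b • ·)) = γ.map (Real.sqrt (a ^ 2 + b ^ 2) • ·)
  hvar : ∀ i, ∫ v, v i ^ 2 ∂γ ≤ V

section steps
variable {d : ℕ} {γ : Measure (EuclideanSpace ℝ (Fin d))} {V : ℝ}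

lemma GM.int (hγ : GM γ V) {F : EuclideanSpace ℝ (Fin d) → ℝ} (hF : Continuous F) (A c : ℝ)
    (hb : ∀ v, |F v| ≤ A * Real.exp (c * ‖v‖)) : Integrable F γ :=
  Integrable.mono' ((hγ.hexp c).const_mul A) hF.aestronglyMeasurable (ae_of_all _ hb)

lemma GM.int_norm_pow_exp (hγ : GM γ V) (k : ℕ) (c : ℝ) :
    Integrable (fun v => ‖v‖ ^ k * Real.exp (c * ‖v‖)) γ := by
  apply hγ.int (by fun_prop) (k.factorial) (c + 1)
  intro v
  have h := Real.pow_div_factorial_le_exp ‖v‖ (norm_nonneg v) k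
  rw [div_le_iff₀ (by positivity)] at h
  rw [abs_of_nonneg (by positivity), add_mul, Real.exp_add, one_mul]
  have := Real.exp_pos (c * ‖v‖)
  nlinarith

lemma GM.int_norm_pow (hγ : GM γ V) (k : ℕ) : Integrable (fun v => ‖v‖ ^ k) γ := by
  simpa using hγ.int_norm_pow_exp k 0

lemma GM.int_sq (hγ : GM γ V) (i : Fin d) : Integrable (fun v => v i ^ 2) γ := by
  apply Integrable.mono' (hγ.int_norm_pow 2) (by fun_prop)
  refine ae_of_all _ fun v => ?_
  rw [Real.norm_eq_abs, abs_pow]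
  gcongr
  exact coord_le v i

lemma GM.int_coord (hγ : GM γ V) (i : Fin d) : Integrable (fun v => v i) γ := by
  apply Integrable.mono' (hγ.int_norm_pow 1) (by fun_prop)
  refine ae_of_all _ fun v => ?_
  simpa using coord_le v i

lemma Nice.growth {C : ℝ} {g : EuclideanSpace ℝ (Fin d) → ℝ}
    {q : EuclideanSpace ℝ (Fin d) → Fin d → ℝ} (h : Nice C g q) (x v) (s : ℝ) :
    |g (x + s • v)| ≤ |g x| + |s| * ‖v‖ := by
  have := h.lip x (s • v)
  rw [norm_smul, Real.norm_eq_abs] at this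
  have h2 := abs_sub_abs_le_abs_sub (g (x + s • v)) (g x)
  linarith

lemma GM.int_nice [IsProbabilityMeasure γ] (hγ : GM γ V) {C : ℝ} {g : EuclideanSpace ℝ (Fin d) → ℝ}
    {q : EuclideanSpace ℝ (Fin d) → Fin d → ℝ} (h : Nice C g q) (x) (s : ℝ) :
    Integrable (fun v => g (x + s • v)) γ := by
  have hc := h.cont
  refine Integrable.mono' (((hγ.int_norm_pow 1).const_mul |s|).add (integrable_const |g x|))
    (Continuous.aestronglyMeasurable (by fun_prop)) (ae_of_all _ fun v => ?_)
  simpa [add_comm] using h.growth x v s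

lemma Nice.exp_growth {C : ℝ} {g : EuclideanSpace ℝ (Fin d) → ℝ}
    {q : EuclideanSpace ℝ (Fin d) → Fin d → ℝ} (h : Nice C g q) (x v) (s : ℝ) {l : ℝ} (hl : 0 ≤ l) :
    |Real.exp (l * g (x + s • v))| ≤ Real.exp (l * |g x|) * Real.exp ((l * |s|) * ‖v‖) := by
  rw [abs_of_pos (Real.exp_pos _), ← Real.exp_add, Real.exp_le_exp]
  have := (le_abs_self _).trans (h.growth x v s)
  calc _ ≤ l * (|g x| + |s| * ‖v‖) := by gcongr
    _ = _ := by ring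

lemma GM.int_exp_nice (hγ : GM γ V) {C : ℝ} {g : EuclideanSpace ℝ (Fin d) → ℝ}
    {q : EuclideanSpace ℝ (Fin d) → Fin d → ℝ} (h : Nice C g q) (x) (s : ℝ) {l : ℝ} (hl : 0 ≤ l) :
    Integrable (fun v => Real.exp (l * g (x + s • v))) γ := by
  have hc := h.cont
  exact hγ.int (by fun_prop) _ _ (fun v => h.exp_growth x v s hl)

lemma GM.onestep [IsProbabilityMeasure γ] (hγ : GM γ V) {C : ℝ} {g : EuclideanSpace ℝ (Fin d) → ℝ}
    {q : EuclideanSpace ℝ (Fin d) → Fin d → ℝ} (h : Nice C g q) (x : EuclideanSpace ℝ (Fin d))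
    {r : ℝ} (hr : 0 ≤ r) (hr1 : r ≤ 1) {l : ℝ} (hl : 0 ≤ l) :
    ∫ v, Real.exp (l * g (x + r • v)) ∂γ ≤ Real.exp (l * ∫ v, g (x + r • v) ∂γ
      + (l ^ 2 * V / 2 * r ^ 2 + r ^ 3 * (l ^ 2 * C * ∫ v, ‖v‖ ^ 3 ∂γ
        + l ^ 3 * ∫ v, ‖v‖ ^ 3 * Real.exp (l * ‖v‖) ∂γ))) := by
  have pt : ∀ v, Real.exp (l * g (x + r • v)) ≤ Real.exp (l * g x) *
      (1 - l * g x + l * g (x + r • v) + l ^ 2 / 2 * r ^ 2 * (∑ i, q x i * v i ^ 2)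
       + l ^ 2 * C * r ^ 3 * ‖v‖ ^ 3 + l ^ 3 * r ^ 3 * (‖v‖ ^ 3 * Real.exp (l * ‖v‖))) := by
    intro v
    set z := g (x + r • v) - g x with hz
    have e1 : l * g (x + r • v) = l * g x + l * z := by rw [hz]; ring
    have hn : ‖r • v‖ = r * ‖v‖ := by rw [norm_smul, Real.norm_eq_abs, abs_of_nonneg hr]
    have hz1 : |z| ≤ r * ‖v‖ := by rw [← hn]; exact h.lip x _
    have hw1 := wsum_le _ (h.nonneg x) (h.sum_one x) (r • v)
    have hq := h.quad x (r • v)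
    have hw2 := wsum_sq_le _ (h.nonneg x) (h.sum_one x) (r • v)
    rw [hn] at hw1 hq
    rw [← hz] at hq
    set w := ∑ i, q x i * (r • v) i with hw
    have e2 : ∑ i, q x i * (r • v) i ^ 2 = r ^ 2 * ∑ i, q x i * v i ^ 2 := by
      rw [Finset.mul_sum]
      apply Finset.sum_congr rfl; intro i _
      simp only [PiLp.smul_apply, smul_eq_mul]; ring
    rw [e2] at hw2
    have hz2 : z ^ 2 ≤ r ^ 2 * (∑ i, q x i * v i ^ 2) + 2 * C * (r * ‖v‖) ^ 3 := by
      have : z ^ 2 - w ^ 2 ≤ |z - w| * |z + w| := by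
        rw [← abs_mul]
        exact (le_of_eq (by ring)).trans (le_abs_self _)
      have h2 : |z + w| ≤ 2 * (r * ‖v‖) := by linarith [abs_add_le z w]
      have h3 : |z - w| * |z + w| ≤ (C * (r * ‖v‖) ^ 2) * (2 * (r * ‖v‖)) :=
        mul_le_mul hq h2 (abs_nonneg _) ((abs_nonneg _).trans hq)
      nlinarith
    have hlz : |l * z| ≤ l * (r * ‖v‖) := by
      rw [abs_mul, abs_of_nonneg hl]; gcongr
    have hc : |l * z| ^ 3 * Real.exp |l * z| ≤ (l * (r * ‖v‖)) ^ 3 * Real.exp (l * ‖v‖) := by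
      have : |l * z| ≤ l * ‖v‖ := hlz.trans (by
        gcongr; exact mul_le_of_le_one_left (norm_nonneg v) hr1)
      gcongr
    have hE := exp_third (l * z)
    rw [e1, Real.exp_add]
    apply mul_le_mul_of_nonneg_left _ (Real.exp_pos _).le
    have h6 : (l * z) ^ 2 / 2 ≤ l ^ 2 / 2 * (r ^ 2 * (∑ i, q x i * v i ^ 2) + 2 * C * (r * ‖v‖) ^ 3) := by
      rw [mul_pow]
      nlinarith [sq_nonneg l]
    nlinarith
  have i1 := hγ.int_nice h x r
  have i2 : Integrable (fun v => ∑ i, q x i * v i ^ 2) γ :=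
    integrable_finsetSum _ (fun i _ => (hγ.int_sq i).const_mul _)
  have i3 := hγ.int_norm_pow 3
  have i4 := hγ.int_norm_pow_exp 3 l
  have hV : ∫ v, (∑ i, q x i * v i ^ 2) ∂γ ≤ V := by
    rw [integral_finsetSum _ (fun i _ => (hγ.int_sq i).const_mul _)]
    simp_rw [integral_const_mul]
    calc _ ≤ ∑ i, q x i * V := Finset.sum_le_sum fun i _ =>
          mul_le_mul_of_nonneg_left (hγ.hvar i) (h.nonneg x i)
      _ = V := by rw [← Finset.sum_mul, h.sum_one, one_mul]
  have j1 : Integrable (fun v => 1 - l * g x + l * g (x + r • v)) γ :=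
    (integrable_const _).add (i1.const_mul l)
  have j2 := j1.add (i2.const_mul (l ^ 2 / 2 * r ^ 2))
  have j3 := j2.add (i3.const_mul (l ^ 2 * C * r ^ 3))
  have j4 := j3.add (i4.const_mul (l ^ 3 * r ^ 3))
  have := integral_mono (hγ.int_exp_nice h x r hl) (j4.const_mul (Real.exp (l * g x))) pt
  refine this.trans ?_
  rw [integral_const_mul]
  simp only [Pi.add_apply]
  rw [integral_add (by exact j3) (i4.const_mul _), integral_add (by exact j2) (i3.const_mul _),
    integral_add j1 (i2.const_mul _), integral_add (integrable_const _) (i1.const_mul _)]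
  simp only [integral_const_mul, integral_const, probReal_univ, smul_eq_mul, one_mul]
  set I1 := ∫ v, g (x + r • v) ∂γ
  set I2 := ∫ v, (∑ i, q x i * v i ^ 2) ∂γ
  set I3 := ∫ v, ‖v‖ ^ 3 ∂γ
  set I4 := ∫ v, ‖v‖ ^ 3 * Real.exp (l * ‖v‖) ∂γ
  have hh : l ^ 2 / 2 * r ^ 2 * I2 ≤ l ^ 2 / 2 * r ^ 2 * V :=
    mul_le_mul_of_nonneg_left hV (by positivity)
  set Y := - (l * g x) + l * I1 + l ^ 2 / 2 * r ^ 2 * V + l ^ 2 * C * r ^ 3 * I3 + l ^ 3 * r ^ 3 * I4 with hY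
  calc _ ≤ Real.exp (l * g x) * (Y + 1) := by
        apply mul_le_mul_of_nonneg_left _ (Real.exp_pos _).le
        rw [hY]; linarith
    _ ≤ Real.exp (l * g x) * Real.exp Y := by
        apply mul_le_mul_of_nonneg_left (Real.add_one_le_exp Y) (Real.exp_pos _).le
    _ = _ := by
        rw [← Real.exp_add, hY]; congr 1; ring

lemma GM.avg [IsProbabilityMeasure γ] (hγ : GM γ V) {C : ℝ} {g : EuclideanSpace ℝ (Fin d) → ℝ}
    {q : EuclideanSpace ℝ (Fin d) → Fin d → ℝ} (h : Nice C g q)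
    (hq : ∀ i, Continuous (fun x => q x i)) (s : ℝ) :
    Nice C (fun x => ∫ v, g (x + s • v) ∂γ) (fun x i => ∫ v, q (x + s • v) i ∂γ) := by
  have hq1 : ∀ x i, |q x i| ≤ 1 := by
    intro x i
    rw [abs_of_nonneg (h.nonneg x i), ← h.sum_one x]
    exact Finset.single_le_sum (fun i _ => h.nonneg x i) (Finset.mem_univ i)
  have iq : ∀ x i, Integrable (fun v => q (x + s • v) i) γ := by
    intro x i
    have := hq i
    exact Integrable.mono' (integrable_const 1) (Continuous.aestronglyMeasurable (by fun_prop))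
      (ae_of_all _ fun v => hq1 _ i)
  have comm : ∀ x u v : EuclideanSpace ℝ (Fin d), x + u + s • v = (x + s • v) + u := by
    intros; abel
  constructor
  · intro x u
    rw [← integral_sub (hγ.int_nice h _ s) (hγ.int_nice h _ s)]
    have := norm_integral_le_of_norm_le_const (μ := γ) (C := ‖u‖)
      (f := fun v => g (x + u + s • v) - g (x + s • v))
      (ae_of_all _ fun v => by rw [comm]; exact h.lip _ u)
    simpa using this
  · intro x i; exact integral_nonneg fun v => h.nonneg _ i
  · intro x
    rw [← integral_finsetSum _ (fun i _ => iq x i)]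
    simp [h.sum_one]
  · intro x u
    have e : ∑ i, (∫ v, q (x + s • v) i ∂γ) * u i = ∫ v, ∑ i, q (x + s • v) i * u i ∂γ := by
      rw [integral_finsetSum _ (fun i _ => (iq x i).mul_const _)]
      simp_rw [integral_mul_const]
    simp only
    rw [e, ← integral_sub (hγ.int_nice h _ s) (hγ.int_nice h _ s),
      ← integral_sub (by exact (hγ.int_nice h _ s).sub (hγ.int_nice h _ s))
        (integrable_finsetSum _ (fun i _ => (iq x i).mul_const _))]
    have := norm_integral_le_of_norm_le_const (μ := γ) (C := C * ‖u‖ ^ 2)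
      (f := fun v => g (x + u + s • v) - g (x + s • v) - ∑ i, q (x + s • v) i * u i)
      (ae_of_all _ fun v => by rw [comm]; exact h.quad _ u)
    simpa using this

lemma GM.conv [IsProbabilityMeasure γ] (hγ : GM γ V) {F : EuclideanSpace ℝ (Fin d) → ℝ}
    (hF : Continuous F) (x : EuclideanSpace ℝ (Fin d)) (a b : ℝ)
    (hi : Integrable (fun v => F (x + Real.sqrt (a ^ 2 + b ^ 2) • v)) γ) :
    ∫ v, F (x + Real.sqrt (a ^ 2 + b ^ 2) • v) ∂γ = ∫ u, ∫ v, F (x + a • u + b • v) ∂γ ∂γ := by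
  have hm : ∀ c : ℝ, AEMeasurable (fun v : EuclideanSpace ℝ (Fin d) => c • v) γ :=
    fun c => by fun_prop
  have hG : Continuous (fun y => F (x + y)) := by fun_prop
  have e1 : ∫ v, F (x + Real.sqrt (a ^ 2 + b ^ 2) • v) ∂γ
      = ∫ y, F (x + y) ∂((γ.map (a • ·)) ∗ (γ.map (b • ·))) := by
    rw [hγ.hrot, integral_map (hm _) hG.aestronglyMeasurable]
  have : ∀ c : ℝ, IsProbabilityMeasure (γ.map (c • ·)) := fun c =>
    Measure.isProbabilityMeasure_map (hm c)
  rw [e1, integral_conv]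
  · rw [integral_map (hm a)]
    · congr 1; ext u
      rw [integral_map (hm b) (Continuous.aestronglyMeasurable (by fun_prop))]
      simp_rw [add_assoc]
    · refine StronglyMeasurable.aestronglyMeasurable ?_
      refine StronglyMeasurable.integral_prod_right (f := fun u v => F (x + (u + v))) ?_
      exact Continuous.stronglyMeasurable (by unfold Function.uncurry; fun_prop)
  · rw [hγ.hrot, integrable_map_measure hG.aestronglyMeasurable (hm _)]
    exact hi

lemma GM.iter [IsProbabilityMeasure γ] (hγ : GM γ V) {C : ℝ} {g : EuclideanSpace ℝ (Fin d) → ℝ}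
    {q : EuclideanSpace ℝ (Fin d) → Fin d → ℝ} (h : Nice C g q)
    (hq : ∀ i, Continuous (fun x => q x i))
    {r : ℝ} (hr : 0 ≤ r) (hr1 : r ≤ 1) {l : ℝ} (hl : 0 ≤ l) (k : ℕ) :
    ∀ x, ∫ v, Real.exp (l * g (x + (Real.sqrt k * r) • v)) ∂γ ≤
      Real.exp (l * ∫ v, g (x + (Real.sqrt k * r) • v) ∂γ
      + k * (l ^ 2 * V / 2 * r ^ 2 + r ^ 3 * (l ^ 2 * C * ∫ v, ‖v‖ ^ 3 ∂γ
        + l ^ 3 * ∫ v, ‖v‖ ^ 3 * Real.exp (l * ‖v‖) ∂γ))) := by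
  set ε := (l ^ 2 * V / 2 * r ^ 2 + r ^ 3 * (l ^ 2 * C * ∫ v, ‖v‖ ^ 3 ∂γ
        + l ^ 3 * ∫ v, ‖v‖ ^ 3 * Real.exp (l * ‖v‖) ∂γ)) with hε
  induction k with
  | zero => intro x; simp
  | succ k ih =>
    intro x
    have hs : Real.sqrt ((k + 1 : ℕ) : ℝ) * r = Real.sqrt (r ^ 2 + (Real.sqrt k * r) ^ 2) := by
      have : r ^ 2 + (Real.sqrt k * r) ^ 2 = ((k + 1 : ℕ) : ℝ) * r ^ 2 := by
        rw [mul_pow, Real.sq_sqrt (by positivity)]; push_cast; ring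
      rw [this, Real.sqrt_mul (by positivity), Real.sqrt_sq hr]
    have hc := h.cont
    have i1 := hγ.int_exp_nice h x (Real.sqrt (r ^ 2 + (Real.sqrt k * r) ^ 2)) hl
    have i2 := hγ.int_nice h x (Real.sqrt (r ^ 2 + (Real.sqrt k * r) ^ 2))
    have hA := hγ.avg h hq (Real.sqrt k * r)
    have hcA := hA.cont
    rw [hs, hγ.conv (F := fun y => Real.exp (l * g y)) (by fun_prop) x _ _ i1,
      hγ.conv hc x _ _ i2]
    have j := (hγ.int_exp_nice hA x r hl).mul_const (Real.exp (k * ε))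
    calc _ ≤ ∫ u, Real.exp (l * ∫ v, g (x + r • u + (Real.sqrt k * r) • v) ∂γ)
              * Real.exp (k * ε) ∂γ := by
          apply integral_mono_of_nonneg (ae_of_all _ fun u => integral_nonneg fun v => (Real.exp_pos _).le) j
          refine ae_of_all _ fun u => ?_
          simp only
          rw [← Real.exp_add]
          exact ih (x + r • u)
      _ = (∫ u, Real.exp (l * ∫ v, g (x + r • u + (Real.sqrt k * r) • v) ∂γ) ∂γ)
              * Real.exp (k * ε) := integral_mul_const _ _
      _ ≤ Real.exp (l * (∫ u, ∫ v, g (x + r • u + (Real.sqrt k * r) • v) ∂γ ∂γ) + ε)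
              * Real.exp (k * ε) := by
          apply mul_le_mul_of_nonneg_right _ (Real.exp_pos _).le
          exact hγ.onestep hA x hr hr1 hl
      _ = _ := by rw [← Real.exp_add]; congr 1; push_cast; ring

lemma GM.mgf_le [IsProbabilityMeasure γ] (hγ : GM γ V) {C : ℝ} {g : EuclideanSpace ℝ (Fin d) → ℝ}
    {q : EuclideanSpace ℝ (Fin d) → Fin d → ℝ} (h : Nice C g q)
    (hq : ∀ i, Continuous (fun x => q x i)) {l : ℝ} (hl : 0 ≤ l) (x : EuclideanSpace ℝ (Fin d)) :
    ∫ v, Real.exp (l * g (x + v)) ∂γ ≤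
      Real.exp (l * ∫ v, g (x + v) ∂γ + l ^ 2 * V / 2) := by
  set K := (l ^ 2 * C * ∫ v, ‖v‖ ^ 3 ∂γ
        + l ^ 3 * ∫ v, ‖v‖ ^ 3 * Real.exp (l * ‖v‖) ∂γ) with hK
  have hlim : Filter.Tendsto (fun n : ℕ => Real.exp (l * ∫ v, g (x + v) ∂γ + l ^ 2 * V / 2
      + (Real.sqrt ((n + 1 : ℕ) : ℝ))⁻¹ * K)) Filter.atTop
      (nhds (Real.exp (l * ∫ v, g (x + v) ∂γ + l ^ 2 * V / 2 + 0 * K))) := by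
    apply (Real.continuous_exp.tendsto _).comp
    apply Filter.Tendsto.const_add
    apply Filter.Tendsto.mul_const
    apply Filter.Tendsto.inv_tendsto_atTop
    exact Real.tendsto_sqrt_atTop.comp
      (tendsto_natCast_atTop_atTop.comp (Filter.tendsto_add_atTop_nat 1))
  rw [zero_mul, add_zero] at hlim
  refine ge_of_tendsto' hlim fun n => ?_
  have hp : (0:ℝ) < ((n + 1 : ℕ) : ℝ) := by positivity
  set s := Real.sqrt ((n + 1 : ℕ) : ℝ) with hs
  have hs1 : 1 ≤ s := by rw [hs, Real.one_le_sqrt]; push_cast; linarith [n.cast_nonneg (α := ℝ)]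
  have hss : ((n + 1 : ℕ) : ℝ) = s ^ 2 := by rw [hs, Real.sq_sqrt hp.le]
  have hs0 : s ≠ 0 := by positivity
  have := hγ.iter h hq (r := s⁻¹) (by positivity) (inv_le_one_of_one_le₀ hs1) hl (n + 1) x
  rw [← hs, mul_inv_cancel₀ hs0, hss] at this
  simp only [one_smul] at this
  refine this.trans (le_of_eq ?_)
  congr 1
  rw [← hK]
  field_simp
  ring

end steps

section gauss
open ProbabilityTheory
variable {d : ℕ}

lemma max_cont (hne : (Finset.univ : Finset (Fin d)).Nonempty) :
    Continuous (fun y : EuclideanSpace ℝ (Fin d) => Finset.univ.sup' hne y) := by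
  apply Continuous.finset_sup'_apply hne
  intro i _; fun_prop

lemma mgf_max_le {γ : Measure (EuclideanSpace ℝ (Fin d))} {V : ℝ} [IsProbabilityMeasure γ]
    (hd : 0 < d) (hγ : GM γ V) (hne : (Finset.univ : Finset (Fin d)).Nonempty)
    {l : ℝ} (hl : 0 ≤ l) (m : EuclideanSpace ℝ (Fin d)) :
    Integrable (fun v => Real.exp (l * Finset.univ.sup' hne (m + v).ofLp)) γ ∧
    ∫ v, Real.exp (l * Finset.univ.sup' hne (m + v).ofLp) ∂γ ≤
      Real.exp (l * ∫ v, Finset.univ.sup' hne (m + v).ofLp ∂γ + l ^ 2 * V / 2) := by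
  have hc := max_cont hne
  have hM : ∀ b : ℝ, 0 < b → ∀ v, Real.exp (l * Finset.univ.sup' hne (m + v).ofLp) ≤ Real.exp (l * lse b (m + v)) := by
    intro b hb v
    have := max_le_lse hd hb (m + v) hne
    gcongr
  have ie : ∀ b : ℝ, 0 < b → Integrable (fun v => Real.exp (l * lse b (m + v))) γ := by
    intro b hb
    simpa using hγ.int_exp_nice (lse_nice hd hb) m 1 hl
  have il : ∀ b : ℝ, 0 < b → Integrable (fun v => lse b (m + v)) γ := by
    intro b hb
    simpa using hγ.int_nice (lse_nice hd hb) m 1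
  have hcm : Continuous (fun v : EuclideanSpace ℝ (Fin d) => Finset.univ.sup' hne (m + v).ofLp) :=
    hc.comp (continuous_const.add continuous_id)
  have iM : Integrable (fun v => Finset.univ.sup' hne (m + v).ofLp) γ := by
    refine Integrable.mono' ((il 1 one_pos).abs.add (integrable_const (|Real.log d / 1|)))
      hcm.aestronglyMeasurable (ae_of_all _ fun v => ?_)
    have h1 := max_le_lse hd one_pos (m + v) hne
    have h2 := lse_le_max hd one_pos (m + v) hne
    simp only [Pi.add_apply, Real.norm_eq_abs]
    rw [abs_le]
    constructor
    · linarith [neg_abs_le (lse 1 (m+v)), le_abs_self (Real.log d / 1)]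
    · linarith [le_abs_self (lse 1 (m+v)), abs_nonneg (Real.log d / 1)]
  have iE : Integrable (fun v => Real.exp (l * Finset.univ.sup' hne (m + v).ofLp)) γ := by
    refine Integrable.mono' (ie 1 one_pos)
      (Continuous.aestronglyMeasurable (Real.continuous_exp.comp (continuous_const.mul hcm)))
      (ae_of_all _ fun v => ?_)
    rw [Real.norm_eq_abs, abs_of_pos (Real.exp_pos _)]
    exact hM 1 one_pos v
  refine ⟨iE, ?_⟩
  have hlim : Filter.Tendsto (fun n : ℕ => Real.exp (l * (∫ v, Finset.univ.sup' hne (m + v).ofLp ∂γ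
      + Real.log d / ((n + 1 : ℕ) : ℝ)) + l ^ 2 * V / 2)) Filter.atTop
      (nhds (Real.exp (l * (∫ v, Finset.univ.sup' hne (m + v).ofLp ∂γ + 0) + l ^ 2 * V / 2))) := by
    apply (Real.continuous_exp.tendsto _).comp
    apply Filter.Tendsto.add_const
    apply Filter.Tendsto.const_mul
    apply Filter.Tendsto.const_add
    exact Filter.Tendsto.div_atTop tendsto_const_nhds
      (tendsto_natCast_atTop_atTop.comp (Filter.tendsto_add_atTop_nat 1))
  rw [add_zero] at hlim
  refine ge_of_tendsto' hlim fun n => ?_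
  have hb : (0:ℝ) < ((n + 1 : ℕ) : ℝ) := by positivity
  calc _ ≤ ∫ v, Real.exp (l * lse ((n + 1 : ℕ) : ℝ) (m + v)) ∂γ :=
        integral_mono iE (ie _ hb) (hM _ hb)
    _ ≤ _ := hγ.mgf_le (lse_nice hd hb) (smax_cont hd _) hl m
    _ ≤ _ := by
        have : ∫ v, lse ((n + 1 : ℕ) : ℝ) (m + v) ∂γ ≤
            ∫ v, Finset.univ.sup' hne (m + v).ofLp ∂γ + Real.log d / ((n + 1 : ℕ) : ℝ) := by
          have := integral_mono (il _ hb) (iM.add (integrable_const (Real.log d / ((n + 1 : ℕ) : ℝ))))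
            (fun v => lse_le_max hd hb (m + v) hne)
          refine this.trans (le_of_eq ?_)
          simp only [Pi.add_apply]
          rw [integral_add iM (integrable_const _)]
          simp
        gcongr

lemma quadform (S : Matrix (Fin d) (Fin d) ℝ) (t : EuclideanSpace ℝ (Fin d)) :
    (∑ i, ∑ j, S i j * t i * t j) = t.ofLp ⬝ᵥ (S.mulVec t.ofLp) := by
  simp only [dotProduct, Matrix.mulVec, Finset.mul_sum]
  refine Finset.sum_congr rfl fun i _ => Finset.sum_congr rfl fun j _ => by ring

lemma gaussian_GM (S : Matrix (Fin d) (Fin d) ℝ) (hS : S.PosSemidef) (V : ℝ)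
    (hV : ∀ i, S i i ≤ V) : GM (multivariateGaussian 0 S) V := by
  refine ⟨?_, ?_, ?_⟩
  · intro c
    obtain ⟨C, hC, hi⟩ := IsGaussian.exists_integrable_exp_sq (multivariateGaussian 0 S)
    refine Integrable.mono' (hi.const_mul (Real.exp (c ^ 2 / (4 * C))))
      (Continuous.aestronglyMeasurable (by fun_prop)) (ae_of_all _ fun v => ?_)
    rw [Real.norm_eq_abs, abs_of_pos (Real.exp_pos _), ← Real.exp_add, Real.exp_le_exp]
    have : c ^ 2 / (4 * C) + C * ‖v‖ ^ 2 - c * ‖v‖ = C * (‖v‖ - c / (2 * C)) ^ 2 := by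
      field_simp; ring
    have h2 : 0 ≤ C * (‖v‖ - c / (2 * C)) ^ 2 := by positivity
    linarith
  · intro a b
    have : ∀ c : ℝ, IsProbabilityMeasure ((multivariateGaussian 0 S).map (c • ·)) := fun c =>
      Measure.isProbabilityMeasure_map (by fun_prop)
    apply Measure.ext_of_charFun
    ext t
    rw [charFun_conv, charFun_map_smul, charFun_map_smul, charFun_map_smul,
      charFun_multivariateGaussian hS, charFun_multivariateGaussian hS,
      charFun_multivariateGaussian hS, ← Complex.exp_add]
    congr 1
    simp only [inner_zero_right, WithLp.ofLp_smul, Matrix.mulVec_smul, smul_dotProduct, dotProduct_smul, smul_eq_mul]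
    have : ∀ c e : ℝ, c * (c * e) = c ^ 2 * e := fun c e => by ring
    rw [this, this, this, Real.sq_sqrt (by positivity)]
    push_cast
    ring
  · intro i
    have h := variance_eval_multivariateGaussian (μ := 0) hS i
    have h0 : ∫ v, v i ∂(multivariateGaussian 0 S) = 0 := by
      have := integral_id_multivariateGaussian (μ := 0) (S := S)
      have h3 := (EuclideanSpace.proj (𝕜 := ℝ) i : EuclideanSpace ℝ (Fin d) →L[ℝ] ℝ).integral_comp_comm
        (IsGaussian.integrable_fun_id (μ := multivariateGaussian 0 S))
      rw [this] at h3
      simpa using h3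
    rw [variance_of_integral_eq_zero (by fun_prop) h0] at h
    exact h.le.trans (hV i)

lemma P_eq {P : Measure (EuclideanSpace ℝ (Fin d))}
    {m : EuclideanSpace ℝ (Fin d)} {S : Matrix (Fin d) (Fin d) ℝ}
    (hP : IsGaussianMeasure P m S) (hpsd : S.PosSemidef) :
    P = (multivariateGaussian 0 S).map (m + ·) := by
  have := hP.1
  have : IsProbabilityMeasure ((multivariateGaussian 0 S).map (m + ·)) :=
    Measure.isProbabilityMeasure_map (by fun_prop)
  apply Measure.ext_of_charFun
  ext t
  rw [charFun_map_const_add, charFun_multivariateGaussian hpsd, ← Complex.exp_add]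
  have h := hP.2 t
  rw [quadform] at h
  have e : charFun P t = ∫ x, Complex.exp (Complex.I * ((∑ i, t i * x i : ℝ) : ℂ)) ∂P := by
    rw [charFun_apply]
    congr 1; ext x
    rw [mul_comm]
    simp [PiLp.inner_apply]
  rw [e, h]
  congr 1
  have : (∑ i, m i * t i : ℝ) = inner ℝ m t := by
    simp [PiLp.inner_apply, mul_comm]
  rw [this, inner_zero_right]
  push_cast
  ring

end gauss

/-- Concentration of the coordinate maximum of a Gaussian vector:
`P(max_i X_i - E max_i X_i ≥ x) ≤ exp(-x²/(2σ*²))` with `σ*² = max_i Σ_{ii}`. -/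
theorem stmt14 {d : ℕ} (hd : 0 < d) (P : Measure (EuclideanSpace ℝ (Fin d)))
    (m : EuclideanSpace ℝ (Fin d)) (S : Matrix (Fin d) (Fin d) ℝ)
    (hP : IsGaussianMeasure P m S) (hS : S.IsSymm) (hpsd : S.PosSemidef)
    (x : ℝ) (hx : 0 < x) :
    (P {y : EuclideanSpace ℝ (Fin d) | x ≤
        Finset.univ.sup' (Finset.univ_nonempty_iff.mpr (Fin.pos_iff_nonempty.mp hd)) y -
          ∫ z, Finset.univ.sup' (Finset.univ_nonempty_iff.mpr (Fin.pos_iff_nonempty.mp hd)) z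
            ∂P}).toReal ≤
      Real.exp (-x ^ 2 /
        (2 * Finset.univ.sup' (Finset.univ_nonempty_iff.mpr (Fin.pos_iff_nonempty.mp hd))
          (fun i => S i i))) := by
  have hne : (Finset.univ : Finset (Fin d)).Nonempty :=
    Finset.univ_nonempty_iff.mpr (Fin.pos_iff_nonempty.mp hd)
  have hprob := hP.1
  set V := Finset.univ.sup' (Finset.univ_nonempty_iff.mpr (Fin.pos_iff_nonempty.mp hd))
          (fun i => S i i) with hVdef
  have hV : ∀ i, S i i ≤ V := fun i => Finset.le_sup' (fun i => S i i) (Finset.mem_univ i)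
  have hV0 : 0 ≤ V := (hpsd.diag_nonneg (i := ⟨0, hd⟩)).trans (hV ⟨0, hd⟩)
  rcases hV0.eq_or_lt with h0 | hVpos
  · rw [← h0]
    simp only [mul_zero, div_zero, Real.exp_zero]
    exact measureReal_le_one
  have hGM := gaussian_GM S hpsd V hV
  set γ := ProbabilityTheory.multivariateGaussian 0 S with hγ
  have hPe : P = γ.map (m + ·) := P_eq hP hpsd
  have hc := max_cont hne
  have hl : 0 ≤ x / V := by positivity
  obtain ⟨hi, hm⟩ := mgf_max_le hd hGM hne hl m
  have hEM : ∫ z, Finset.univ.sup' hne z ∂P = ∫ v, Finset.univ.sup' hne (m + v).ofLp ∂γ := by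
    rw [hPe, integral_map (by fun_prop) hc.aestronglyMeasurable]
  have hce : Continuous (fun y : EuclideanSpace ℝ (Fin d) =>
      Real.exp (x / V * Finset.univ.sup' hne y)) :=
    Real.continuous_exp.comp (continuous_const.mul hc)
  have hEE : ∫ z, Real.exp (x / V * Finset.univ.sup' hne z) ∂P
      = ∫ v, Real.exp (x / V * Finset.univ.sup' hne (m + v).ofLp) ∂γ := by
    rw [hPe, integral_map (by fun_prop) hce.aestronglyMeasurable]
  have hiP : Integrable (fun y : EuclideanSpace ℝ (Fin d) =>
      Real.exp (x / V * Finset.univ.sup' hne y)) P := by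
    rw [hPe, integrable_map_measure hce.aestronglyMeasurable (by fun_prop)]
    exact hi
  rw [← hEM, ← hEE] at hm
  set A := ∫ z, Finset.univ.sup' hne z ∂P with hA
  have hset : {y : EuclideanSpace ℝ (Fin d) | x ≤ Finset.univ.sup' hne y - A}
      = {y : EuclideanSpace ℝ (Fin d) | x + A ≤ Finset.univ.sup' hne y} := by
    ext y; simp only [Set.mem_ofPred_eq, le_sub_iff_add_le]
  have := ProbabilityTheory.measure_ge_le_exp_mul_mgf
    (X := fun y : EuclideanSpace ℝ (Fin d) => Finset.univ.sup' hne y) (μ := P) (x + A) hl hiP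
  change P.real {y : EuclideanSpace ℝ (Fin d) | x ≤ Finset.univ.sup' hne y - A} ≤ _
  rw [hset]
  refine this.trans ?_
  calc _ ≤ Real.exp (-(x / V) * (x + A)) * Real.exp (x / V * A + (x / V) ^ 2 * V / 2) :=
        mul_le_mul_of_nonneg_left hm (Real.exp_pos _).le
    _ = _ := by
        rw [← Real.exp_add]; congr 1
        field_simp
        ring
end
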